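/- Let n ≥ 1 and p > 1. Let u ∈ C²(ℝⁿ₊) ∩ C(cl ℝⁿ₊) be a classical solution of -Δu = |∇u|^p in ℝⁿ₊ with u = 0 on ∂ℝⁿ₊. Then u depends only on the variable xₙ. -/

import Mathlib

/-- The classical Laplacian of `u : ℝⁿ → ℝ`: the sum of the pure second
derivatives `∂²u/∂xᵢ²`. -/
noncomputable def laplacian {n : ℕ} (u : EuclideanSpace ℝ (Fin n) → ℝ)
    (x : EuclideanSpace ℝ (Fin n)) : ℝ :=
  ∑ i, iteratedFDeriv ℝ 2 u x ![EuclideanSpace.single i 1, EuclideanSpace.single i 1]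

/-- The open half-space `ℝⁿ₊ = {x ∈ ℝⁿ : xₙ > 0}` (dimension `n + 1`, so `n + 1 ≥ 1`). -/
def halfSpace (n : ℕ) : Set (EuclideanSpace ℝ (Fin (n + 1))) :=
  {x | 0 < x (Fin.last n)}

namespace OneDim
open Filter Topology Set

/-- `f` is differentiable near `x`, with first derivative `a` and second derivative `b` at `x`. -/
def D2 (f : ℝ → ℝ) (x a b : ℝ) : Prop :=
  ∃ f' : ℝ → ℝ, (∀ᶠ t in 𝓝 x, HasDerivAt f (f' t) t) ∧ f' x = a ∧ HasDerivAt f' b x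

theorem D2.hasDerivAt {f : ℝ → ℝ} {x a b : ℝ} (h : D2 f x a b) : HasDerivAt f a x := by
  obtain ⟨f', h1, h2, -⟩ := h
  exact h2 ▸ h1.self_of_nhds

theorem D2.congr {f : ℝ → ℝ} {x a b a' b' : ℝ} (h : D2 f x a b) (ha : a = a') (hb : b = b') :
    D2 f x a' b' := by subst ha hb; exact h

theorem D2.add {f g : ℝ → ℝ} {x a b c d : ℝ} (h : D2 f x a b) (k : D2 g x c d) :
    D2 (fun t => f t + g t) x (a + c) (b + d) := by
  obtain ⟨f', h1, h2, h3⟩ := h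
  obtain ⟨g', k1, k2, k3⟩ := k
  refine ⟨fun t => f' t + g' t, ?_, by simp [h2, k2], h3.add k3⟩
  filter_upwards [h1, k1] with t ht kt using ht.add kt

theorem D2.neg {f : ℝ → ℝ} {x a b : ℝ} (h : D2 f x a b) :
    D2 (fun t => - f t) x (-a) (-b) := by
  obtain ⟨f', h1, h2, h3⟩ := h
  refine ⟨fun t => - f' t, ?_, by simp [h2], h3.neg⟩
  filter_upwards [h1] with t ht using ht.neg

theorem D2.sub {f g : ℝ → ℝ} {x a b c d : ℝ} (h : D2 f x a b) (k : D2 g x c d) :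
    D2 (fun t => f t - g t) x (a - c) (b - d) := by
  have := h.add k.neg
  simpa [sub_eq_add_neg] using this

theorem D2.mul {f g : ℝ → ℝ} {x a b c d : ℝ} (h : D2 f x a b) (k : D2 g x c d) :
    D2 (fun t => f t * g t) x (a * g x + f x * c) (b * g x + 2 * a * c + f x * d) := by
  have hf := h.hasDerivAt
  have hg := k.hasDerivAt
  obtain ⟨f', h1, h2, h3⟩ := h
  obtain ⟨g', k1, k2, k3⟩ := k
  refine ⟨fun t => f' t * g t + f t * g' t, ?_, by simp [h2, k2], ?_⟩
  · filter_upwards [h1, k1] with t ht kt using ht.mul kt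
  · have := (h3.mul hg).add (hf.mul k3)
    exact this.congr_deriv (by rw [h2, k2]; ring)

theorem D2.quad (c0 c1 c2 x : ℝ) :
    D2 (fun t => c0 + c1 * t + c2 * t ^ 2) x (c1 + 2 * c2 * x) (2 * c2) := by
  refine ⟨fun t => c1 + 2 * c2 * t, ?_, rfl, ?_⟩
  · refine Eventually.of_forall fun t => ?_
    have := (((hasDerivAt_id t).const_mul c1).const_add c0).add (((hasDerivAt_id t).pow 2).const_mul c2)
    exact this.congr_deriv (by simp; ring)
  · have := ((hasDerivAt_id x).const_mul (2 * c2)).const_add c1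
    exact this.congr_deriv (by simp)

theorem D2.const (c x : ℝ) : D2 (fun _ => c) x 0 0 := by
  have := D2.quad c 0 0 x
  simpa using this

theorem D2.const_mul {f : ℝ → ℝ} {x a b : ℝ} (c : ℝ) (h : D2 f x a b) :
    D2 (fun t => c * f t) x (c * a) (c * b) := by
  refine ((D2.const c x).mul h).congr ?_ ?_ <;> ring

theorem D2.comp {F f : ℝ → ℝ} {x A B a b : ℝ} (hF : D2 F (f x) A B) (h : D2 f x a b) :
    D2 (fun t => F (f t)) x (A * a) (B * a ^ 2 + A * b) := by
  have hf := h.hasDerivAt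
  obtain ⟨f', h1, h2, h3⟩ := h
  obtain ⟨F', k1, k2, k3⟩ := hF
  refine ⟨fun t => F' (f t) * f' t, ?_, by simp [h2, k2], ?_⟩
  · filter_upwards [h1, hf.continuousAt.eventually k1] with t ht kt
    exact kt.comp t ht
  · have := (k3.comp x hf).mul h3
    exact this.congr_deriv (by simp [h2, k2]; ring)

theorem D2.congr_fun {f g : ℝ → ℝ} {x a b : ℝ} (h : D2 f x a b) (e : ∀ t, g t = f t) :
    D2 g x a b := by
  have : g = f := funext e
  rw [this]; exact h

theorem D2.scale {f : ℝ → ℝ} {a b : ℝ} (c : ℝ) (h : D2 f 0 a b) :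
    D2 (fun t => f (c * t)) 0 (c * a) (c ^ 2 * b) := by
  have h1 : D2 (fun t : ℝ => 0 + c * t + 0 * t ^ 2) 0 c 0 := (D2.quad 0 c 0 0).congr (by ring) (by ring)
  have h2 : D2 f ((fun t : ℝ => 0 + c * t + 0 * t ^ 2) 0) a b := by simpa using h
  have h3 := D2.comp (f := fun t : ℝ => 0 + c * t + 0 * t ^ 2) h2 h1
  refine D2.congr_fun (h3.congr (by ring) (by ring)) (fun t => by simp)

theorem D2.isLocalMax {f : ℝ → ℝ} {x a b : ℝ} (h : D2 f x a b) (hm : ∀ᶠ t in 𝓝 x, f t ≤ f x) :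
    a = 0 ∧ b ≤ 0 := by
  have hmax : IsLocalMax f x := hm
  have ha : a = 0 := hmax.hasDerivAt_eq_zero h.hasDerivAt
  refine ⟨ha, ?_⟩
  by_contra hb
  push Not at hb
  obtain ⟨f', h1, h2, h3⟩ := h
  have hd : deriv f =ᶠ[𝓝 x] f' := by
    filter_upwards [h1] with t ht using ht.deriv
  have hdd : deriv (deriv f) x = b := by rw [hd.deriv_eq]; exact h3.deriv
  have hmin : IsLocalMin f x := isLocalMin_of_deriv_deriv_pos (by rw [hdd]; exact hb)
    (by rw [hd.self_of_nhds, h2, ha]) h1.self_of_nhds.continuousAt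
  have hconst : f =ᶠ[𝓝 x] fun _ => f x := by
    filter_upwards [hm, hmin] with t h1 h2 using le_antisymm h1 h2
  have : deriv f =ᶠ[𝓝 x] fun _ => 0 := by
    have := hconst.deriv
    filter_upwards [this] with t ht
    rw [ht]; simp
  rw [this.deriv_eq] at hdd
  simp at hdd
  linarith

/-- Euclidean space of dimension `n+1`. -/
abbrev E (n : ℕ) := EuclideanSpace ℝ (Fin (n + 1))

/-- Basis vectors. -/
noncomputable abbrev bv {n : ℕ} (i : Fin (n + 1)) : E n := EuclideanSpace.single i (1 : ℝ)

/-- Pointwise second-order version of the equation. -/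
def Sol {n : ℕ} (p : ℝ) (u : E n → ℝ) (x g : E n) : Prop :=
  ∃ h : Fin (n + 1) → ℝ, (∀ i, D2 (fun t => u (x + t • bv i)) 0 (g i) (h i)) ∧
    ∑ i, h i = -‖g‖ ^ p

theorem D2_line {n : ℕ} {u : E n → ℝ} {x : E n} (hu : ContDiffAt ℝ 2 u x) (e : E n) :
    D2 (fun t : ℝ => u (x + t • e)) 0 (fderiv ℝ u x e) (fderiv ℝ (fderiv ℝ u) x e e) := by
  have hl : ∀ t : ℝ, HasDerivAt (fun t : ℝ => x + t • e) e t := fun t => by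
    simpa using ((hasDerivAt_id t).smul_const e).const_add x
  have hev : ∀ᶠ y in 𝓝 x, ContDiffAt ℝ 2 u y := hu.eventually (by simp)
  have hct : Tendsto (fun t : ℝ => x + t • e) (𝓝 0) (𝓝 x) := by
    have := (hl 0).continuousAt.tendsto
    simpa using this
  refine ⟨fun t => fderiv ℝ u (x + t • e) e, ?_, by simp, ?_⟩
  · filter_upwards [hct.eventually hev] with t ht
    exact (ht.differentiableAt (by norm_num)).hasFDerivAt.comp_hasDerivAt t (hl t)
  · have h2 : ContDiffAt ℝ 1 (fderiv ℝ u) x := hu.fderiv_right (by norm_num)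
    have h3 := (h2.differentiableAt (by norm_num)).hasFDerivAt
    have h3' : HasFDerivAt (fderiv ℝ u) (fderiv ℝ (fderiv ℝ u) x) (x + (0:ℝ) • e) := by simpa using h3
    have h4 := h3'.comp_hasDerivAt (0:ℝ) (hl 0)
    exact h4.clm_apply (hasDerivAt_const 0 e) |>.congr_deriv (by simp)

theorem sol_of_eq {n : ℕ} {p : ℝ} {u : E n → ℝ} {x : E n} (hu : ContDiffAt ℝ 2 u x)
    (he : -laplacian u x = ‖gradient u x‖ ^ p) : Sol p u x (gradient u x) := by
  refine ⟨fun i => fderiv ℝ (fderiv ℝ u) x (bv i) (bv i), fun i => ?_, ?_⟩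
  · refine (D2_line hu (bv i)).congr ?_ rfl
    have h1 : fderiv ℝ u x = InnerProductSpace.toDual ℝ (E n) (gradient u x) := by
      simp [gradient]
    rw [h1, InnerProductSpace.toDual_apply_apply, EuclideanSpace.inner_single_right]
    simp
  · rw [← he]
    simp [laplacian, iteratedFDeriv_two_apply]

/-- Second-order touching lemma, from above. -/
theorem touch {f ψ : ℝ → ℝ} {a b c d : ℝ} (hf : D2 f 0 a b) (hψ : D2 ψ 0 c d)
    (h : ∀ᶠ t in 𝓝 (0:ℝ), f t - ψ t ≤ f 0 - ψ 0) : a = c ∧ b ≤ d := by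
  have := (hf.sub hψ).isLocalMax h
  constructor <;> linarith [this.1, this.2]

theorem sq_line {n : ℕ} (w : E n) (i : Fin (n + 1)) (t : ℝ) :
    ‖w + t • bv i‖ ^ 2 = ‖w‖ ^ 2 + 2 * w i * t + t ^ 2 := by
  rw [norm_add_sq_real, norm_smul, inner_smul_right]
  simp [bv, EuclideanSpace.inner_single_right, mul_pow]
  ring

theorem coord_line {n : ℕ} (w : E n) (i j : Fin (n + 1)) (t : ℝ) :
    (w + t • bv i) j = w j + (if j = i then 1 else 0) * t := by
  simp [bv, PiLp.single_apply, mul_comm]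

theorem sum_sq {n : ℕ} (w : E n) : ∑ i, w i ^ 2 = ‖w‖ ^ 2 := by
  rw [EuclideanSpace.norm_sq_eq]; simp

theorem line_tendsto {n : ℕ} (x : E n) (e : E n) :
    Tendsto (fun t : ℝ => x + t • e) (𝓝 0) (𝓝 x) := by
  have : Continuous (fun t : ℝ => x + t • e) := by fun_prop
  simpa using this.tendsto 0

end OneDim

namespace OneDim
open Filter Topology Set

theorem hasDerivAt_invpow (k : ℕ) {s : ℝ} (hs : s ≠ 0) :
    HasDerivAt (fun s : ℝ => (s⁻¹) ^ k) (-(k * (s⁻¹) ^ (k + 1))) s := by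
  have := (hasDerivAt_inv hs).pow k
  refine this.congr_deriv ?_
  rcases k with _ | k
  · simp
  · have : (s ^ 2)⁻¹ = s⁻¹ ^ 2 := by rw [inv_pow]
    rw [this]
    simp only [Nat.add_sub_cancel]
    ring

theorem D2_invpow (k : ℕ) {s : ℝ} (hs : s ≠ 0) :
    D2 (fun s : ℝ => (s⁻¹) ^ k) s (-(k * (s⁻¹) ^ (k + 1))) (k * (k + 1) * (s⁻¹) ^ (k + 2)) := by
  refine ⟨fun s => -(k * (s⁻¹) ^ (k + 1)), ?_, rfl, ?_⟩
  · filter_upwards [isOpen_ne.mem_nhds hs] with t ht using hasDerivAt_invpow k ht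
  · have := ((hasDerivAt_invpow (k + 1) hs).const_mul (k : ℝ)).neg
    refine this.congr_deriv ?_
    push_cast; ring

/-- The barrier profile, blowing up at `t = 1`. -/
noncomputable def phi (k : ℕ) (t : ℝ) : ℝ := (((1 - t)⁻¹) ^ k - 1) / k

theorem D2_phi {k : ℕ} (hk : 1 ≤ k) {t : ℝ} (ht : t < 1) :
    D2 (phi k) t (((1 - t)⁻¹) ^ (k + 1)) ((k + 1) * ((1 - t)⁻¹) ^ (k + 2)) := by
  have hk0 : (k : ℝ) ≠ 0 := by positivity
  have h1 : D2 (fun t : ℝ => 1 + (-1) * t + 0 * t ^ 2) t (-1) 0 :=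
    (D2.quad 1 (-1) 0 t).congr (by ring) (by ring)
  have h2 : D2 (fun s : ℝ => (s⁻¹) ^ k) ((fun t : ℝ => 1 + (-1) * t + 0 * t ^ 2) t)
      (-(k * ((1 - t)⁻¹) ^ (k + 1))) (k * (k + 1) * ((1 - t)⁻¹) ^ (k + 2)) := by
    have : (fun t : ℝ => 1 + (-1) * t + 0 * t ^ 2) t = 1 - t := by ring
    rw [this]
    exact D2_invpow k (by linarith)
  have h3 := (((D2.comp (f := fun t : ℝ => 1 + (-1) * t + 0 * t ^ 2) h2 h1).sub
    (D2.const 1 t)).const_mul ((k:ℝ)⁻¹))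
  refine D2.congr_fun (h3.congr ?_ ?_) (fun t => ?_)
  · field_simp; simp
  · field_simp; simp; ring
  · unfold phi
    rw [show (1 + -1 * t + 0 * t ^ 2 : ℝ) = 1 - t by ring]
    field_simp

theorem phi_mono {k : ℕ} {s t : ℝ} (hst : s ≤ t) (ht : t < 1) : phi k s ≤ phi k t := by
  unfold phi
  have : (1 - s)⁻¹ ≤ (1 - t)⁻¹ := inv_anti₀ (by linarith) (by linarith)
  have h0 : 0 ≤ (1 - s)⁻¹ := inv_nonneg.2 (by linarith)
  gcongr

theorem phi_zero (k : ℕ) : phi k 0 = 0 := by simp [phi]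

theorem le_phi {k : ℕ} (hk : 1 ≤ k) {t : ℝ} (h0 : 0 ≤ t) (ht : t < 1) : t ≤ phi k t := by
  unfold phi
  have hk0 : (0 : ℝ) < k := by positivity
  rw [le_div_iff₀ hk0]
  have h1 : 1 + t ≤ (1 - t)⁻¹ := by
    rw [le_inv_comm₀ (by linarith) (by linarith), inv_eq_one_div, le_div_iff₀ (by linarith)]
    nlinarith
  have h2 : 1 + (k : ℝ) * t ≤ (1 + t) ^ k := one_add_mul_le_pow (by linarith) k
  have h3 : (1 + t) ^ k ≤ ((1 - t)⁻¹) ^ k := by gcongr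
  linarith

theorem phi_nonneg {k : ℕ} (hk : 1 ≤ k) {t : ℝ} (h0 : 0 ≤ t) (ht : t < 1) : 0 ≤ phi k t :=
  h0.trans (le_phi hk h0 ht)

theorem phi_le {k : ℕ} (hk : 1 ≤ k) {t : ℝ} (h0 : 0 ≤ t) (ht : t < 1) :
    phi k t ≤ t * ((1 - t)⁻¹) ^ (k + 1) := by
  unfold phi
  have hk0 : (0 : ℝ) < k := by positivity
  rw [div_le_iff₀ hk0]
  have h2 : 1 + (k : ℝ) * (-t) ≤ (1 + -t) ^ k := one_add_mul_le_pow (by linarith) k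
  rw [← sub_eq_add_neg 1 t] at h2
  have hx : 0 < (1 - t)⁻¹ := inv_pos.2 (by linarith)
  have hx1 : 1 ≤ (1 - t)⁻¹ := (one_le_inv₀ (by linarith)).2 (by linarith)
  have h3 : (1 - t) ^ k * ((1 - t)⁻¹) ^ k = 1 := by
    rw [← mul_pow, mul_inv_cancel₀ (by linarith), one_pow]
  have h4 : 0 < ((1 - t)⁻¹) ^ k := by positivity
  have h5 : ((1 - t)⁻¹) ^ k ≤ ((1 - t)⁻¹) ^ (k + 1) := pow_le_pow_right₀ hx1 (by omega)
  have h6 : ((1 - t)⁻¹) ^ k - 1 ≤ t * ((1 - t)⁻¹) ^ k * k := by nlinarith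
  have : t * ((1 - t)⁻¹) ^ k * k ≤ t * ((1 - t)⁻¹) ^ (k + 1) * k := by gcongr
  linarith

theorem phi_large {k : ℕ} (hk : 1 ≤ k) (M r : ℝ) (hr : r < 1) :
    ∃ t, r < t ∧ 0 < t ∧ t < 1 ∧ M ≤ phi k t := by
  have hk0 : (0 : ℝ) < k := by positivity
  have h1 : Tendsto (fun t : ℝ => (1 - t)⁻¹) (𝓝[<] 1) atTop := by
    apply Filter.Tendsto.inv_tendsto_nhdsGT_zero
    refine tendsto_nhdsWithin_iff.2 ⟨?_, ?_⟩
    · have : Continuous (fun t : ℝ => 1 - t) := by fun_prop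
      have h := this.tendsto 1
      simp only [sub_self] at h
      exact h.mono_left nhdsWithin_le_nhds
    · filter_upwards [self_mem_nhdsWithin] with t ht
      simpa using ht
  have h2 : ∀ᶠ t in 𝓝[<] (1:ℝ), 1 + k * |M| ≤ (1 - t)⁻¹ := h1.eventually_ge_atTop _
  have h3 : ∀ᶠ t in 𝓝[<] (1:ℝ), max r 0 < t := by
    have : ∀ᶠ t in 𝓝 (1:ℝ), max r 0 < t := lt_mem_nhds (by simp [hr])
    exact this.filter_mono nhdsWithin_le_nhds
  obtain ⟨t, h2, h3, h4⟩ := (h2.and (h3.and self_mem_nhdsWithin)).exists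
  refine ⟨t, (le_max_left _ _).trans_lt h3, (le_max_right _ _).trans_lt h3, h4, ?_⟩
  unfold phi
  rw [le_div_iff₀ hk0]
  have hx1 : 1 ≤ (1 - t)⁻¹ := le_trans (by have := abs_nonneg M; nlinarith) h2
  have : (1 - t)⁻¹ ≤ ((1 - t)⁻¹) ^ k := le_self_pow₀ hx1 (by omega)
  nlinarith [le_abs_self M]

/-- The localisation factor. -/
noncomputable def Lf {n : ℕ} (K : ℝ) (k : ℕ) (y : E n) : ℝ := K * ((1 - ‖y‖ ^ 2)⁻¹) ^ k

theorem pair_test {n : ℕ} {p : ℝ} {U : E n → ℝ} {x y gx gy : E n}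
    (hx : Sol p U x gx) (hy : Sol p U y gy) {K : ℝ} (hK : 0 < K) {k : ℕ} (hk : 1 ≤ k)
    {t d δ ξ : ℝ} (ht : t = ‖x - y‖) (ht0 : 0 < t) (ht1 : t < 1) (hd : d = 1 - ‖y‖ ^ 2)
    (hd0 : 0 < d) (hδ : δ = d⁻¹) (hξ : ξ = (1 - t)⁻¹)
    (hmax : ∀ᶠ P : E n × E n in 𝓝 (x, y), U P.2 - U P.1 - Lf K k P.2 * phi k ‖P.1 - P.2‖ ≤
      U y - U x - Lf K k y * phi k ‖x - y‖) (a : ℝ) :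
    (∀ i, a * gy i - gx i = a * (2 * k * K * δ ^ (k + 1) * y i) * phi k t +
      K * δ ^ k * ξ ^ (k + 1) * ((1 - a) * (x - y) i / t)) ∧
    ‖gx‖ ^ p - a ^ 2 * ‖gy‖ ^ p ≤
      a ^ 2 * phi k t * (K * (4 * k * (k + 1) * δ ^ (k + 2) * ‖y‖ ^ 2
        + 2 * k * δ ^ (k + 1) * (n + 1)))
      + 2 * a * (1 - a) * ξ ^ (k + 1) * (2 * k * K * δ ^ (k + 1)) * (∑ i, y i * (x - y) i) / t
      + K * δ ^ k * (1 - a) ^ 2 * ((k + 1) * ξ ^ (k + 2) + (n + 1) * ξ ^ (k + 1) / t) := by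
  obtain ⟨hx2, hx1, hxs⟩ := hx
  obtain ⟨hy2, hy1, hys⟩ := hy
  have key : ∀ i, a * gy i - gx i = a * (2 * k * K * δ ^ (k + 1) * y i) * phi k t +
      K * δ ^ k * ξ ^ (k + 1) * ((1 - a) * (x - y) i / t) ∧
      a ^ 2 * hy2 i - hx2 i ≤ a ^ 2 * phi k t * (K * (4 * k * (k + 1) * δ ^ (k + 2) * y i ^ 2
        + 2 * k * δ ^ (k + 1)))
      + 2 * a * (1 - a) * ξ ^ (k + 1) * (2 * k * K * δ ^ (k + 1)) * (y i * (x - y) i) / t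
      + K * δ ^ k * (1 - a) ^ 2 * ((k + 1) * ξ ^ (k + 2) * ((x - y) i ^ 2 / t ^ 2)
        + ξ ^ (k + 1) / t) := by
    intro i
    -- the localisation factor along the line
    have hdl : D2 (fun τ : ℝ => d + (-(2 * a * y i)) * τ + (-(a ^ 2)) * τ ^ 2) 0
        (-(2 * a * y i)) (-(2 * a ^ 2)) := (D2.quad _ _ _ 0).congr (by ring) (by ring)
    have hL1 : D2 (fun s : ℝ => (s⁻¹) ^ k)
        ((fun τ : ℝ => d + (-(2 * a * y i)) * τ + (-(a ^ 2)) * τ ^ 2) 0)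
        (-(k * δ ^ (k + 1))) (k * (k + 1) * δ ^ (k + 2)) := by
      have : (fun τ : ℝ => d + (-(2 * a * y i)) * τ + (-(a ^ 2)) * τ ^ 2) 0 = d := by simp
      rw [this, hδ]
      exact D2_invpow k hd0.ne'
    have hL := (D2.comp (f := fun τ : ℝ => d + (-(2 * a * y i)) * τ + (-(a ^ 2)) * τ ^ 2)
      hL1 hdl).const_mul K
    have hql : D2 (fun τ : ℝ => t + ((1 - a) * (x - y) i / t) * τ + ((1 - a) ^ 2 / (2 * t)) * τ ^ 2)
        0 ((1 - a) * (x - y) i / t) ((1 - a) ^ 2 / t) :=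
      (D2.quad _ _ _ 0).congr (by ring) (by field_simp)
    have hP1 : D2 (phi k)
        ((fun τ : ℝ => t + ((1 - a) * (x - y) i / t) * τ + ((1 - a) ^ 2 / (2 * t)) * τ ^ 2) 0)
        (ξ ^ (k + 1)) ((k + 1) * ξ ^ (k + 2)) := by
      have : (fun τ : ℝ => t + ((1 - a) * (x - y) i / t) * τ
        + ((1 - a) ^ 2 / (2 * t)) * τ ^ 2) 0 = t := by simp
      rw [this, hξ]
      exact D2_phi hk ht1
    have hP := D2.comp (f := fun τ : ℝ => t + ((1 - a) * (x - y) i / t) * τ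
      + ((1 - a) ^ 2 / (2 * t)) * τ ^ 2) hP1 hql
    have hΨ := hL.mul hP
    have hf := ((hy1 i).scale a).sub (hx1 i)
    have hlx : Tendsto (fun τ : ℝ => x + τ • bv i) (𝓝 0) (𝓝 x) := line_tendsto x (bv i)
    have hly : Tendsto (fun τ : ℝ => y + (a * τ) • bv i) (𝓝 0) (𝓝 y) := by
      have : Continuous (fun τ : ℝ => y + (a * τ) • bv i) := by fun_prop
      simpa using this.tendsto 0
    have hlp : Tendsto (fun τ : ℝ => (x + τ • bv i, y + (a * τ) • bv i)) (𝓝 0) (𝓝 (x, y)) :=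
      hlx.prodMk_nhds hly
    have hqc : ∀ᶠ τ in 𝓝 (0:ℝ), t + ((1 - a) * (x - y) i / t) * τ
        + ((1 - a) ^ 2 / (2 * t)) * τ ^ 2 < 1 := by
      have : Continuous (fun τ : ℝ => t + ((1 - a) * (x - y) i / t) * τ
        + ((1 - a) ^ 2 / (2 * t)) * τ ^ 2) := by fun_prop
      have h := this.tendsto 0
      refine h.eventually (gt_mem_nhds ?_)
      simpa using ht1
    have hdc : ∀ᶠ τ in 𝓝 (0:ℝ), 0 < d + (-(2 * a * y i)) * τ + (-(a ^ 2)) * τ ^ 2 := by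
      have : Continuous (fun τ : ℝ => d + (-(2 * a * y i)) * τ + (-(a ^ 2)) * τ ^ 2) := by fun_prop
      have h := this.tendsto 0
      refine h.eventually (lt_mem_nhds ?_)
      simpa using hd0
    have hT := touch hf hΨ (by
      filter_upwards [hlp.eventually hmax, hqc, hdc] with τ h1 h2 h3
      have e1 : Lf K k (y + (a * τ) • bv i) =
          K * ((d + (-(2 * a * y i)) * τ + (-(a ^ 2)) * τ ^ 2)⁻¹) ^ k := by
        unfold Lf
        rw [sq_line, hd]
        congr 3; ring
      have e2 : x + τ • bv i - (y + (a * τ) • bv i) = (x - y) + ((1 - a) * τ) • bv i := by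
        module
      have e3 : ‖(x - y) + ((1 - a) * τ) • bv i‖ ≤ t + ((1 - a) * (x - y) i / t) * τ
        + ((1 - a) ^ 2 / (2 * t)) * τ ^ 2 := by
        have h := sq_line (x - y) i ((1 - a) * τ)
        rw [← ht] at h
        set r := ‖(x - y) + ((1 - a) * τ) • bv i‖
        have e4 : t + ((1 - a) * (x - y) i / t) * τ + ((1 - a) ^ 2 / (2 * t)) * τ ^ 2
          = (r ^ 2 + t ^ 2) / (2 * t) := by
          rw [h]; field_simp; ring
        rw [e4, le_div_iff₀ (by positivity)]
        nlinarith [sq_nonneg (r - t)]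
      have e5 := phi_mono (k := k) e3 h2
      have e6 : 0 ≤ Lf K k (y + (a * τ) • bv i) := by
        rw [e1]; positivity
      have e7 := mul_le_mul_of_nonneg_left e5 e6
      rw [e2] at h1
      rw [← e1]
      have e8 : Lf K k y * phi k ‖x - y‖ = K * ((d + (-(2 * a * y i)) * 0 + (-(a ^ 2)) * 0 ^ 2)⁻¹) ^ k
         * phi k (t + ((1 - a) * (x - y) i / t) * 0 + ((1 - a) ^ 2 / (2 * t)) * 0 ^ 2) := by
        rw [← ht]; unfold Lf; rw [← hd]; simp
      rw [← e8]
      simp only [mul_zero, zero_smul, add_zero]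
      linarith)
    obtain ⟨hT1, hT2⟩ := hT
    have z1 : d + (-(2 * a * y i)) * 0 + (-(a ^ 2)) * 0 ^ 2 = d := by ring
    have z2 : t + ((1 - a) * (x - y) i / t) * 0 + ((1 - a) ^ 2 / (2 * t)) * 0 ^ 2 = t := by ring
    rw [z1, z2, ← hδ] at hT1 hT2
    refine ⟨hT1.trans ?_, hT2.trans (le_of_eq ?_)⟩
    · ring
    · ring
  refine ⟨fun i => (key i).1, ?_⟩
  have hsum := Finset.sum_le_sum (fun i (_ : i ∈ Finset.univ) => (key i).2)
  rw [Finset.sum_sub_distrib, ← Finset.mul_sum, hys, hxs] at hsum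
  refine le_trans (le_of_eq (by ring)) (hsum.trans (le_of_eq ?_))
  simp only [Finset.sum_add_distrib, ← Finset.mul_sum, ← Finset.sum_div, Finset.sum_const,
    Finset.card_univ, Fintype.card_fin, nsmul_eq_mul, sum_sq]
  rw [← ht, div_self (by positivity)]
  push_cast
  ring

end OneDim

namespace OneDim
open Filter Topology Set

theorem one_add_rpow_le {p x : ℝ} (hp : 1 < p) (h0 : 0 ≤ x) (h1 : x ≤ 1) :
    (1 + x) ^ p ≤ 1 + 2 ^ p * x := by
  have hc := (convexOn_rpow hp.le).2 (show (1:ℝ) ∈ Set.Ici (0:ℝ) by simp)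
    (show (2:ℝ) ∈ Set.Ici (0:ℝ) by simp) (show 0 ≤ 1 - x by linarith) h0 (by ring)
  simp only [smul_eq_mul, Real.one_rpow] at hc
  have : (1 - x) * 1 + x * 2 = 1 + x := by ring
  rw [this] at hc
  nlinarith

set_option maxHeartbeats 1000000 in
theorem no_max {n : ℕ} {p : ℝ} (hp : 1 < p) {U : E n → ℝ} {x y gx gy : E n}
    (hx : Sol p U x gx) (hy : Sol p U y gy) {K : ℝ} (hK : 0 < K) {k : ℕ} (hk : 1 ≤ k)
    (hkp : 1 ≤ k * (p - 1)) {κ N c1 c2 c3 c4 : ℝ} (hκ : κ = K ^ (p - 1)) (hN : N = n + 1)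
    (hc1 : c1 = 4 * k * (k + 1) + 2 * k * N) (hc2 : c2 = 2 ^ (k + 1))
    (hc3 : c3 = (k + 1) * 2 ^ (k + 2)) (hc4 : c4 = 2 * k * 2 ^ p)
    (h1 : 2 * (k + 1) ≤ κ) (h2 : 4 * N ≤ κ) (h3 : 2 * N * c4 ≤ κ)
    (h4 : c1 * c2 + 4 * k * c2 + c3 + c4 * N * c2 < κ)
    {t d : ℝ} (ht : t = ‖x - y‖) (ht0 : 0 < t) (ht1 : t < 1) (hd : d = 1 - ‖y‖ ^ 2)
    (hd0 : 0 < d)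
    (hmax : ∀ᶠ P : E n × E n in 𝓝 (x, y), U P.2 - U P.1 - Lf K k P.2 * phi k ‖P.1 - P.2‖ ≤
      U y - U x - Lf K k y * phi k ‖x - y‖) : False := by
  obtain ⟨δ, hδ⟩ : ∃ δ, δ = d⁻¹ := ⟨_, rfl⟩
  obtain ⟨ξ, hξ⟩ : ∃ ξ, ξ = (1 - t)⁻¹ := ⟨_, rfl⟩
  have test := pair_test hx hy hK hk ht ht0 ht1 hd hd0 hδ hξ hmax
  have hk1 : (1 : ℝ) ≤ k := by exact_mod_cast hk
  have hN1 : 1 ≤ N := by rw [hN]; have : (0:ℝ) ≤ n := n.cast_nonneg; linarith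
  have hy1 : ‖y‖ ^ 2 ≤ 1 := by linarith
  have hd1 : d ≤ 1 := by rw [hd]; linarith [sq_nonneg ‖y‖]
  have hδ1 : 1 ≤ δ := by rw [hδ]; exact (one_le_inv₀ hd0).2 hd1
  have hξ1 : 1 ≤ ξ := by rw [hξ]; exact (one_le_inv₀ (by linarith)).2 (by linarith)
  have h2p : (1:ℝ) ≤ 2 ^ p := Real.one_le_rpow (by norm_num) (by linarith)
  obtain ⟨L, hL⟩ : ∃ L, L = K * δ ^ k := ⟨_, rfl⟩
  have hL0 : 0 < L := by rw [hL]; positivity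
  obtain ⟨f1, hf1⟩ : ∃ f1, f1 = ξ ^ (k + 1) := ⟨_, rfl⟩
  have hf11 : 1 ≤ f1 := by rw [hf1]; exact one_le_pow₀ hξ1
  obtain ⟨F, hF⟩ : ∃ F, F = f1 ^ p := ⟨_, rfl⟩
  have hFf : f1 ≤ F := by
    rw [hF]; exact Real.self_le_rpow_of_one_le hf11 hp.le
  have hf2 : ξ ^ (k + 2) ≤ F := by
    rw [hF, hf1, ← Real.rpow_natCast, ← Real.rpow_natCast, ← Real.rpow_mul (by linarith)]
    apply Real.rpow_le_rpow_of_exponent_le hξ1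
    push_cast
    nlinarith
  obtain ⟨Q, hQ⟩ : ∃ Q, Q = L ^ (p - 1) := ⟨_, rfl⟩
  have hκ0 : 0 < κ := by linarith
  have hQκ : κ * δ ≤ Q := by
    rw [hQ, hL, Real.mul_rpow hK.le (by positivity), ← hκ]
    refine mul_le_mul_of_nonneg_left ?_ hκ0.le
    rw [← Real.rpow_natCast, ← Real.rpow_mul (by linarith)]
    calc δ = δ ^ (1:ℝ) := (Real.rpow_one _).symm
      _ ≤ _ := Real.rpow_le_rpow_of_exponent_le hδ1 hkp
  have hLp : (L * f1) ^ p = L * Q * F := by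
    rw [Real.mul_rpow hL0.le (by linarith), hQ, hF]
    congr 1
    rw [Real.rpow_sub_one hL0.ne']; field_simp
  -- first order information
  have t0 := test 0
  have t1 := test 1
  have hgx : ∀ i, gx i = -(L * f1 / t) * (x - y) i := by
    intro i
    have := t0.1 i
    rw [← hL, ← hf1] at this
    have e : gx i = -(L * f1 * ((1 - 0) * (x - y) i / t)) := by linarith
    rw [e]; ring
  have hgxv : gx = (-(L * f1 / t)) • (x - y) := by
    ext i
    rw [hgx i]; simp
  have hngx : ‖gx‖ = L * f1 := by
    rw [hgxv, norm_smul, ← ht, norm_neg, Real.norm_of_nonneg (by positivity)]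
    field_simp
  have hgyv : gy = gx + (2 * k * L * δ * phi k t) • y := by
    ext i
    have := t1.1 i
    simp only [sub_self, zero_mul, zero_div, mul_zero, add_zero, one_mul] at this
    simp only [PiLp.add_apply, PiLp.smul_apply, smul_eq_mul, hL]
    have e : gy i = gx i + 2 * k * K * δ ^ (k + 1) * y i * phi k t := by linarith
    rw [e]; ring
  have hφ0 := phi_nonneg hk ht0.le ht1
  have hφ1 : phi k t ≤ t * f1 := by
    have := phi_le hk ht0.le ht1
    rwa [← hξ, ← hf1] at this
  have hyn : ‖y‖ ≤ 1 := (sq_le_one_iff₀ (norm_nonneg y)).1 hy1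
  obtain ⟨σ, hσ⟩ : ∃ σ, σ = δ * t := ⟨_, rfl⟩
  have hσ0 : 0 < σ := by rw [hσ]; positivity
  have hngy : ‖gy‖ ≤ L * f1 * (1 + 2 * k * σ) := by
    rw [hgyv]
    refine (norm_add_le _ _).trans ?_
    rw [norm_smul, hngx, Real.norm_of_nonneg (by positivity)]
    have : 2 * k * L * δ * phi k t * ‖y‖ ≤ 2 * k * L * δ * (t * f1) * 1 := by
      gcongr
    rw [hσ]; linarith
  -- step one
  have s1 := t0.2
  rw [hngx, hLp, ← hL, ← hf1] at s1
  have s1' : L * (Q * F) ≤ L * ((k + 1) * ξ ^ (k + 2) + (n + 1) * f1 / t) := by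
    refine le_trans (le_of_eq (by ring)) (s1.trans (le_of_eq ?_))
    ring
  have s2 := le_of_mul_le_mul_left s1' hL0
  rw [← hN] at s2
  have hF0 : 0 < F := by linarith
  have hQ1 : 2 * (k + 1) ≤ Q := h1.trans ((le_mul_of_one_le_right hκ0.le hδ1).trans hQκ)
  have s3 : Q * F / 2 ≤ N * f1 / t := by
    have z1 : (k + 1 : ℝ) * ξ ^ (k + 2) ≤ (k + 1) * F := by gcongr
    have z2 : 2 * (k + 1) * F ≤ Q * F := by gcongr
    linarith
  have s4 : Q * t ≤ 2 * N := by
    rw [le_div_iff₀ ht0] at s3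
    have hQ0 : 0 < Q := by linarith
    have : Q * f1 / 2 * t ≤ Q * F / 2 * t := by gcongr
    have h5 : f1 * (Q * t) ≤ f1 * (2 * N) := by linarith
    exact le_of_mul_le_mul_left h5 (by linarith)
  have s5 : κ * σ ≤ 2 * N := by
    rw [hσ]
    have : κ * δ * t ≤ Q * t := by gcongr
    linarith
  have hσt : t ≤ σ := by rw [hσ]; exact le_mul_of_one_le_left ht0.le hδ1
  have hthalf : t ≤ 1 / 2 := by
    by_contra hcon
    push Not at hcon
    have z1 : κ * (1 / 2) < κ * σ := by gcongr; linarith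
    linarith
  have hξ2 : ξ ≤ 2 := by
    rw [hξ]
    rw [inv_le_comm₀ (by linarith) (by norm_num)]
    linarith
  have hf1c : f1 ≤ c2 := by rw [hf1, hc2]; gcongr
  have hf2c : (k + 1) * ξ ^ (k + 2) ≤ c3 := by rw [hc3]; gcongr
  -- step two
  have hc40 : 1 ≤ c4 := by
    rw [hc4]
    have z1 : (1:ℝ) * 1 ≤ k * 2 ^ p := by gcongr
    linarith
  obtain ⟨s, hs⟩ : ∃ s, s = c4 * σ := ⟨_, rfl⟩
  have hs0 : 0 < s := by rw [hs]; positivity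
  have hs1 : s ≤ 1 := by
    rw [hs]
    have : κ * (c4 * σ) ≤ κ * 1 := by
      have z1 : c4 * (κ * σ) ≤ c4 * (2 * N) := by gcongr
      linarith
    exact le_of_mul_le_mul_left this hκ0
  have h2kσ : 2 * k * σ ≤ 1 := by
    have : 2 * k * σ ≤ s := by
      rw [hs, hc4]
      have : 2 * k * σ * 1 ≤ 2 * k * σ * 2 ^ p := by gcongr
      linarith
    linarith
  have hP : ‖gy‖ ^ p ≤ L * Q * F * (1 + s) := by
    calc ‖gy‖ ^ p ≤ (L * f1 * (1 + 2 * k * σ)) ^ p :=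
          Real.rpow_le_rpow (norm_nonneg _) hngy (by linarith)
      _ = L * Q * F * (1 + 2 * k * σ) ^ p := by
          rw [Real.mul_rpow (by positivity) (by positivity), hLp]
      _ ≤ L * Q * F * (1 + s) := by
          have hQ0 : 0 < Q := by linarith
          have := one_add_rpow_le hp (x := 2 * k * σ) (by positivity) h2kσ
          have e : 2 ^ p * (2 * k * σ) = s := by rw [hs, hc4]; ring
          rw [e] at this
          gcongr
  have t2 := (test (1 - s)).2
  rw [hngx, hLp] at t2
  have hQ0 : 0 < Q := by linarith
  have hLQF : 0 < L * Q * F := by positivity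
  have lhs : s * (L * (κ * δ)) ≤ L * Q * F - (1 - s) ^ 2 * ‖gy‖ ^ p := by
    have a1 : (1 - s) ^ 2 * ‖gy‖ ^ p ≤ (1 - s) ^ 2 * (L * Q * F * (1 + s)) := by gcongr
    have a2 : (1 - s) ^ 2 * (1 + s) ≤ 1 - s := by
      have z1 : (1 - s) * (1 + s) ≤ 1 := by linarith [sq_nonneg s]
      have z2 := mul_le_mul_of_nonneg_left z1 (show 0 ≤ 1 - s by linarith)
      linarith
    have a3 : (1 - s) ^ 2 * (L * Q * F * (1 + s)) ≤ L * Q * F * (1 - s) := by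
      have := mul_le_mul_of_nonneg_left a2 hLQF.le
      linarith
    have a4 : s * (L * (κ * δ)) ≤ s * (L * Q * F) := by
      have hF1 : 1 ≤ F := by linarith
      have z1 : L * (κ * δ) * 1 ≤ L * Q * F := by gcongr
      have z2 := mul_le_mul_of_nonneg_left z1 hs0.le
      linarith
    linarith
  have hinner : (∑ i, y i * (x - y) i) / t ≤ 1 := by
    rw [div_le_one ht0]
    have e : ∑ i, y i * (x - y) i = inner ℝ (x - y) y := by
      rw [PiLp.inner_apply]
      simp
    rw [e]
    refine (real_inner_le_norm _ _).trans ?_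
    rw [← ht]; exact mul_le_of_le_one_right ht0.le hyn
  rw [← hf1, ← hL, ← hN] at t2
  have b1 : (1 - s) ^ 2 * phi k t * (K * (4 * k * (k + 1) * δ ^ (k + 2) * ‖y‖ ^ 2
        + 2 * k * δ ^ (k + 1) * N)) ≤ L * δ * s * (c1 * c2) := by
    have e1 : K * (4 * k * (k + 1) * δ ^ (k + 2) * ‖y‖ ^ 2 + 2 * k * δ ^ (k + 1) * N) ≤
        L * δ ^ 2 * c1 := by
      have : K * (4 * k * (k + 1) * δ ^ (k + 2) * ‖y‖ ^ 2 + 2 * k * δ ^ (k + 1) * N) ≤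
         K * (4 * k * (k + 1) * δ ^ (k + 2) * 1 + 2 * k * δ ^ (k + 2) * N) := by
        have : δ ^ (k + 1) ≤ δ ^ (k + 2) := pow_le_pow_right₀ hδ1 (by omega)
        gcongr
      refine this.trans (le_of_eq ?_)
      rw [hL, hc1]; ring
    have e2 : (1 - s) ^ 2 * phi k t ≤ t * c2 := by
      have : (1 - s) ^ 2 ≤ 1 := pow_le_one₀ (by linarith) (by linarith)
      calc (1 - s) ^ 2 * phi k t ≤ 1 * (t * f1) := by gcongr
        _ ≤ t * c2 := by rw [one_mul]; gcongr
    have hc1p : 0 < c1 := by rw [hc1]; positivity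
    have hc2p : 0 < c2 := by rw [hc2]; positivity
    calc _ ≤ (t * c2) * (L * δ ^ 2 * c1) := by gcongr
      _ = L * δ * σ * (c1 * c2) := by rw [hσ]; ring
      _ ≤ L * δ * s * (c1 * c2) := by
        have : σ ≤ s := by rw [hs]; exact le_mul_of_one_le_left hσ0.le hc40
        gcongr
  have b2 : 2 * (1 - s) * (1 - (1 - s)) * f1 * (2 * k * K * δ ^ (k + 1)) *
      (∑ i, y i * (x - y) i) / t ≤ L * δ * s * (4 * k * c2) := by
    have e1 : 2 * (1 - s) * (1 - (1 - s)) * f1 * (2 * k * K * δ ^ (k + 1)) *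
      (∑ i, y i * (x - y) i) / t = ((1 - s) * f1 * (4 * k * L * δ * s)) *
        ((∑ i, y i * (x - y) i) / t) := by rw [hL]; ring
    rw [e1]
    have hs' : 0 ≤ 1 - s := by linarith
    calc _ ≤ ((1 - s) * f1 * (4 * k * L * δ * s)) * 1 := by gcongr
      _ ≤ (1 * c2 * (4 * k * L * δ * s)) * 1 := by gcongr; linarith
      _ = _ := by ring
  have b3 : L * (1 - (1 - s)) ^ 2 * ((k + 1) * ξ ^ (k + 2) + N * f1 / t) ≤
      L * δ * s * (c3 + c4 * N * c2) := by
    have e1 : L * (1 - (1 - s)) ^ 2 * ((k + 1) * ξ ^ (k + 2) + N * f1 / t) =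
      L * s * (s * ((k + 1) * ξ ^ (k + 2))) + L * s * (s / t * (N * f1)) := by ring
    have e2 : s / t = c4 * δ := by rw [hs, hσ]; field_simp
    rw [e1, e2]
    have hc3p : 0 < c3 := by rw [hc3]; positivity
    have q1 : s * ((k + 1) * ξ ^ (k + 2)) ≤ δ * c3 := by
      calc s * ((k + 1) * ξ ^ (k + 2)) ≤ 1 * c3 := by gcongr
        _ ≤ δ * c3 := by gcongr
    have q2 : c4 * δ * (N * f1) ≤ c4 * δ * (N * c2) := by gcongr
    calc _ ≤ L * s * (δ * c3) + L * s * (c4 * δ * (N * c2)) := by gcongr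
      _ = _ := by ring
  have fin : L * δ * s * κ ≤ L * δ * s * (c1 * c2 + 4 * k * c2 + c3 + c4 * N * c2) := by
    linarith
  have := le_of_mul_le_mul_left fin (by positivity)
  linarith

set_option maxHeartbeats 1000000 in
theorem grad_unit (n : ℕ) {p : ℝ} (hp : 1 < p) : ∃ (K : ℝ) (k : ℕ), 0 < K ∧ 1 ≤ k ∧
    ∀ (U : E n → ℝ) (G : ℝ), (∀ x, ‖x‖ ≤ 2 → ∃ g, Sol p U x g) → ContinuousOn U (Metric.closedBall 0 2) →
      (∀ x y, ‖x‖ ≤ 2 → ‖y‖ ≤ 2 → U y - U x ≤ G * ‖x - y‖) →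
      ∀ x, ‖x‖ < 1 → U 0 - U x ≤ K * phi k ‖x‖ := by
  have hp0 : 0 < p - 1 := by linarith
  obtain ⟨k, hk⟩ := exists_nat_ge (max 1 (1 / (p - 1)))
  have hk1 : 1 ≤ k := by exact_mod_cast (le_max_left _ _).trans hk
  have hkp : 1 ≤ k * (p - 1) := by
    have := (le_max_right _ _).trans hk
    rwa [div_le_iff₀ hp0] at this
  obtain ⟨N, hN⟩ : ∃ N : ℝ, N = n + 1 := ⟨_, rfl⟩
  obtain ⟨c1, hc1⟩ : ∃ c : ℝ, c = 4 * k * (k + 1) + 2 * k * N := ⟨_, rfl⟩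
  obtain ⟨c2, hc2⟩ : ∃ c : ℝ, c = 2 ^ (k + 1) := ⟨_, rfl⟩
  obtain ⟨c3, hc3⟩ : ∃ c : ℝ, c = (k + 1) * 2 ^ (k + 2) := ⟨_, rfl⟩
  obtain ⟨c4, hc4⟩ : ∃ c : ℝ, c = 2 * k * 2 ^ p := ⟨_, rfl⟩
  have hN0 : 0 < N := by rw [hN]; positivity
  have p1 : 0 < c1 := by rw [hc1]; positivity
  have p2 : 0 < c2 := by rw [hc2]; positivity
  have p3 : 0 < c3 := by rw [hc3]; positivity
  have p4 : 0 < c4 := by rw [hc4]; positivity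
  obtain ⟨κ, hκ⟩ : ∃ κ : ℝ, κ = 2 * (k + 1) + 4 * N + 2 * N * c4 +
    (c1 * c2 + 4 * k * c2 + c3 + c4 * N * c2) := ⟨_, rfl⟩
  have hκ0 : 0 < κ := by rw [hκ]; positivity
  have q1 : 0 < 2 * (k + 1 : ℝ) := by positivity
  have q3 : 0 < 2 * N * c4 := by positivity
  have q4 : 0 < c1 * c2 + 4 * k * c2 + c3 + c4 * N * c2 := by positivity
  refine ⟨κ ^ (p - 1)⁻¹, k, by positivity, hk1, ?_⟩
  obtain ⟨K, hK⟩ : ∃ K, K = κ ^ (p - 1)⁻¹ := ⟨_, rfl⟩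
  have hK0 : 0 < K := by rw [hK]; positivity
  have hKκ : κ = K ^ (p - 1) := by
    rw [hK, ← Real.rpow_mul hκ0.le, inv_mul_cancel₀ hp0.ne', Real.rpow_one]
  rw [← hK]
  intro U G hsol hcont hlip xb hxb
  by_contra hcon
  push Not at hcon
  obtain ⟨r1, hr1a, hr1b, hr1c, hr1d⟩ := phi_large hk1 (|G| / K) ‖xb‖ hxb
  obtain ⟨r2, hr2a, hr2b, hr2c⟩ : ∃ r2 : ℝ, 0 < r2 ∧ r2 < 1 ∧ |G| ≤ K * ((1 - r2 ^ 2)⁻¹) ^ k := by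
    obtain ⟨r, -, h0, h1, h2⟩ := phi_large hk1 (|G| / K) 0 (by norm_num)
    refine ⟨r.sqrt, Real.sqrt_pos.2 h0, by rw [Real.sqrt_lt' one_pos]; linarith, ?_⟩
    rw [Real.sq_sqrt h0.le]
    rw [div_le_iff₀ hK0] at h2
    unfold phi at h2
    have hx : 0 < (1 - r)⁻¹ := inv_pos.2 (by linarith)
    have hk0 : (1:ℝ) ≤ k := by exact_mod_cast hk1
    have h3 : ((1 - r)⁻¹ ^ k - 1) / k ≤ (1 - r)⁻¹ ^ k := by
      rw [div_le_iff₀ (by linarith)]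
      have z1 : 0 < (1 - r)⁻¹ ^ k := by positivity
      have z2 := le_mul_of_one_le_right z1.le hk0
      linarith
    have z3 := mul_le_mul_of_nonneg_right h3 hK0.le
    linarith
  have hr2s : r2 ^ 2 < 1 := pow_lt_one₀ hr2a.le hr2b (by norm_num)
  have hysq : ∀ y : E n, ‖y‖ ≤ r2 → 0 < 1 - ‖y‖ ^ 2 := by
    intro y hy
    have := pow_le_pow_left₀ (norm_nonneg y) hy 2
    linarith
  let Φ : E n × E n → ℝ := fun P => U P.2 - U P.1 - Lf K k P.2 * phi k ‖P.1 - P.2‖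
  let S : Set (E n × E n) := {P | ‖P.2‖ ≤ r2 ∧ ‖P.1 - P.2‖ ≤ r1}
  have hS1 : ∀ P ∈ S, ‖P.1‖ ≤ 2 ∧ ‖P.2‖ ≤ 2 := by
    rintro ⟨x, y⟩ ⟨h1, h2⟩
    simp only at h1 h2 ⊢
    refine ⟨?_, by linarith⟩
    have := norm_add_le (x - y) y
    rw [sub_add_cancel] at this
    linarith
  have hScl : IsClosed S := by
    refine (isClosed_le (f := fun P : E n × E n => ‖P.2‖) (by fun_prop) continuous_const).inter
      (isClosed_le (f := fun P : E n × E n => ‖P.1 - P.2‖) (by fun_prop) continuous_const)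
  have hSc : IsCompact S := by
    refine Metric.isCompact_of_isClosed_isBounded hScl ?_
    refine (Metric.isBounded_closedBall (x := (0 : E n × E n)) (r := 2)).subset ?_
    intro P hP
    rw [mem_closedBall_zero_iff, Prod.norm_def]
    exact max_le (hS1 P hP).1 (hS1 P hP).2
  have hmem : (xb, (0 : E n)) ∈ S := ⟨by simpa using hr2a.le, by simpa using hr1a.le⟩
  have hΦc : ContinuousOn Φ S := by
    have u1 : ContinuousOn (fun P : E n × E n => U P.1) S :=
      hcont.comp continuousOn_fst (fun P hP => by simpa using (hS1 P hP).1)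
    have u2 : ContinuousOn (fun P : E n × E n => U P.2) S :=
      hcont.comp continuousOn_snd (fun P hP => by simpa using (hS1 P hP).2)
    refine (u2.sub u1).sub (ContinuousOn.mul ?_ ?_)
    · unfold Lf
      refine continuousOn_const.mul (ContinuousOn.pow (ContinuousOn.inv₀ (by fun_prop) ?_) k)
      rintro P ⟨h1, h2⟩
      exact (hysq _ h1).ne'
    · unfold phi
      refine ContinuousOn.div_const (ContinuousOn.sub (ContinuousOn.pow
        (ContinuousOn.inv₀ (by fun_prop) ?_) k) continuousOn_const) _
      rintro P ⟨h1, h2⟩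
      linarith
  obtain ⟨⟨x, y⟩, hPS, hPm⟩ := hSc.exists_isMaxOn ⟨_, hmem⟩ hΦc
  have hpos : 0 < Φ (x, y) := by
    refine lt_of_lt_of_le ?_ (hPm hmem)
    simp only [Φ, Lf, sub_zero, norm_zero]
    norm_num
    linarith
  have hxy := hS1 _ hPS
  obtain ⟨hP1, hP2⟩ := hPS
  simp only at hP1 hP2 hxy
  have hlipxy := hlip x y hxy.1 hxy.2
  have hG : G * ‖x - y‖ ≤ |G| * ‖x - y‖ := by gcongr; exact le_abs_self G
  have htpos : 0 < ‖x - y‖ := by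
    rcases (norm_nonneg (x - y)).lt_or_eq with h | h
    · exact h
    · exfalso
      have : x = y := by rw [eq_comm, norm_eq_zero, sub_eq_zero] at h; exact h
      simp [Φ, this, phi_zero] at hpos
  have hLK : K ≤ Lf K k y := by
    unfold Lf
    have : 1 ≤ (1 - ‖y‖ ^ 2)⁻¹ := by
      refine (one_le_inv₀ (hysq y hP1)).2 (by linarith [sq_nonneg ‖y‖])
    exact le_mul_of_one_le_right hK0.le (one_le_pow₀ this)
  have hb1 : ‖x - y‖ < r1 := by
    refine lt_of_le_of_ne hP2 fun h => ?_
    rw [div_le_iff₀ hK0] at hr1d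
    have : |G| * ‖x - y‖ ≤ |G| * 1 := by gcongr; linarith
    have h3 : phi k r1 * K ≤ phi k r1 * Lf K k y := by
      have := phi_nonneg hk1 hr1b.le hr1c
      gcongr
    simp only [Φ, h] at hpos
    rw [h] at this hG hlipxy
    linarith
  have hb2 : ‖y‖ < r2 := by
    refine lt_of_le_of_ne hP1 fun h => ?_
    have h4 := le_phi hk1 htpos.le (hb1.trans hr1c)
    have h5 : |G| ≤ Lf K k y := by unfold Lf; rw [h]; exact hr2c
    simp only [Φ] at hpos
    have : |G| * ‖x - y‖ ≤ Lf K k y * phi k ‖x - y‖ := by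
      exact mul_le_mul h5 h4 htpos.le (hK0.le.trans hLK)
    linarith
  obtain ⟨gx, hgx⟩ := hsol x hxy.1
  obtain ⟨gy, hgy⟩ := hsol y hxy.2
  refine no_max hp hgx hgy hK0 hk1 hkp hKκ hN hc1 hc2 hc3 hc4 ?_ ?_ ?_ ?_ rfl htpos
    (hb1.trans hr1c) rfl ?_ ?_
  · linarith
  · linarith
  · linarith
  · linarith
  · exact hysq y hP1
  · have hop : IsOpen {P : E n × E n | ‖P.2‖ < r2 ∧ ‖P.1 - P.2‖ < r1} := by
      refine (isOpen_lt (f := fun P : E n × E n => ‖P.2‖) (by fun_prop) continuous_const).inter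
        (isOpen_lt (f := fun P : E n × E n => ‖P.1 - P.2‖) (by fun_prop) continuous_const)
    filter_upwards [hop.mem_nhds (x := (x, y)) ⟨hb2, hb1⟩] with P hP
    exact hPm (show P ∈ S from ⟨hP.1.le, hP.2.le⟩)

end OneDim

namespace OneDim
open Filter Topology Set

/-- A classical solution on the half-space (bundled hypotheses). -/
structure HS (n : ℕ) (p : ℝ) (u : E n → ℝ) : Prop where
  cont : ContinuousOn u {x | 0 ≤ x (Fin.last n)}
  bc : ∀ x, x (Fin.last n) = 0 → u x = 0
  cd : ContDiffOn ℝ 2 u {x | 0 < x (Fin.last n)}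
  sol : ∀ x, 0 < x (Fin.last n) → Sol p u x (gradient u x)

theorem continuous_coord {n : ℕ} (j : Fin (n + 1)) : Continuous (fun x : E n => x j) := by
  fun_prop

theorem isOpen_half (n : ℕ) : IsOpen {x : E n | 0 < x (Fin.last n)} :=
  isOpen_lt continuous_const (continuous_coord _)

theorem abs_coord_le {n : ℕ} (x : E n) (j : Fin (n + 1)) : |x j| ≤ ‖x‖ := by
  have := PiLp.norm_apply_le (p := 2) x j
  simpa using this

theorem HS.contDiffAt {n : ℕ} {p : ℝ} {u : E n → ℝ} (h : HS n p u) {x : E n}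
    (hx : 0 < x (Fin.last n)) : ContDiffAt ℝ 2 u x :=
  h.cd.contDiffAt ((isOpen_half n).mem_nhds hx)

theorem HS.hasGradientAt {n : ℕ} {p : ℝ} {u : E n → ℝ} (h : HS n p u) {x : E n}
    (hx : 0 < x (Fin.last n)) : HasGradientAt u (gradient u x) x :=
  ((h.contDiffAt hx).differentiableAt (by norm_num)).hasGradientAt

theorem max_test {n : ℕ} {p : ℝ} {U ψ : E n → ℝ} {x g c : E n} {d : Fin (n + 1) → ℝ}
    (hS : Sol p U x g) (hψ : ∀ i, D2 (fun t => ψ (x + t • bv i)) 0 (c i) (d i))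
    (hm : ∀ᶠ y in 𝓝 x, U y - ψ y ≤ U x - ψ x) : g = c ∧ -‖c‖ ^ p ≤ ∑ i, d i := by
  obtain ⟨h, h1, h2⟩ := hS
  have key : ∀ i, g i = c i ∧ h i ≤ d i := fun i => by
    refine touch (h1 i) (hψ i) ?_
    simpa using (line_tendsto x (bv i)).eventually hm
  have hg : g = c := by ext i; exact (key i).1
  refine ⟨hg, ?_⟩
  rw [← hg, ← h2]
  exact Finset.sum_le_sum fun i _ => (key i).2

theorem min_test {n : ℕ} {p : ℝ} {U ψ : E n → ℝ} {x g c : E n} {d : Fin (n + 1) → ℝ}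
    (hS : Sol p U x g) (hψ : ∀ i, D2 (fun t => ψ (x + t • bv i)) 0 (c i) (d i))
    (hm : ∀ᶠ y in 𝓝 x, U x - ψ x ≤ U y - ψ y) : g = c ∧ ∑ i, d i ≤ -‖c‖ ^ p := by
  obtain ⟨h, h1, h2⟩ := hS
  have key : ∀ i, c i = g i ∧ d i ≤ h i := fun i => by
    refine touch (hψ i) (h1 i) ?_
    have := (line_tendsto x (bv i)).eventually hm
    filter_upwards [this] with t ht
    simp only [zero_smul, add_zero]
    linarith
  have hg : g = c := by ext i; exact (key i).1.symm
  refine ⟨hg, ?_⟩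
  rw [← hg, ← h2]
  exact Finset.sum_le_sum fun i _ => (key i).2

theorem diff_test {n : ℕ} {p : ℝ} {U V ψ : E n → ℝ} {x g g' c : E n} {d : Fin (n + 1) → ℝ}
    (hS : Sol p U x g) (hS' : Sol p V x g')
    (hψ : ∀ i, D2 (fun t => ψ (x + t • bv i)) 0 (c i) (d i))
    (hm : ∀ᶠ y in 𝓝 x, U y - V y - ψ y ≤ U x - V x - ψ x) :
    g - g' = c ∧ ‖g'‖ ^ p - ‖g‖ ^ p ≤ ∑ i, d i := by
  obtain ⟨h, h1, h2⟩ := hS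
  obtain ⟨h', h1', h2'⟩ := hS'
  have key : ∀ i, g i - g' i = c i ∧ h i - h' i ≤ d i := fun i => by
    refine touch ((h1 i).sub (h1' i)) (hψ i) ?_
    simpa using (line_tendsto x (bv i)).eventually hm
  have hg : g - g' = c := by ext i; exact (key i).1
  refine ⟨hg, ?_⟩
  have : ∑ i, h i - ∑ i, h' i = ‖g'‖ ^ p - ‖g‖ ^ p := by rw [h2, h2']; ring
  rw [← this, ← Finset.sum_sub_distrib]
  exact Finset.sum_le_sum fun i _ => (key i).2

theorem sol_scale {n : ℕ} {p : ℝ} {u : E n → ℝ} {x0 z g : E n} {ρ c : ℝ} (hρ : 0 < ρ) (hc : 0 < c)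
    (hcp : c * ρ ^ 2 = (c * ρ) ^ p) (h : Sol p u (x0 + ρ • z) g) :
    Sol p (fun z => c * u (x0 + ρ • z)) z ((c * ρ) • g) := by
  obtain ⟨b, h1, h2⟩ := h
  refine ⟨fun i => c * (ρ ^ 2 * b i), fun i => ?_, ?_⟩
  · refine ((((h1 i).scale ρ).const_mul c).congr (by simp; ring) rfl).congr_fun fun t => ?_
    simp only [smul_add, smul_smul, add_assoc]
  · rw [← Finset.mul_sum, ← Finset.mul_sum, h2, norm_smul, Real.norm_of_nonneg (by positivity),
      Real.mul_rpow (by positivity) (norm_nonneg _), ← hcp]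
    ring

theorem grad_scale {n : ℕ} {u : E n → ℝ} {x0 z g : E n} {ρ c : ℝ}
    (h : HasGradientAt u g (x0 + ρ • z)) :
    HasGradientAt (fun z => c * u (x0 + ρ • z)) ((c * ρ) • g) z := by
  rw [hasGradientAt_iff_hasFDerivAt] at h ⊢
  have h1 : HasFDerivAt (fun z : E n => x0 + ρ • z) (ρ • ContinuousLinearMap.id ℝ (E n)) z :=
    ((hasFDerivAt_id z).const_smul ρ).const_add x0
  have h2 := (h.comp z h1).const_mul c
  refine h2.congr_fderiv ?_
  ext w
  simp
  ring

theorem scale_exp {p ρ : ℝ} (hp : 1 < p) (hρ : 0 < ρ) :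
    ρ ^ ((2 - p) / (p - 1)) * ρ = ρ ^ (p - 1)⁻¹ ∧
    ρ ^ ((2 - p) / (p - 1)) * ρ ^ 2 = (ρ ^ ((2 - p) / (p - 1)) * ρ) ^ p := by
  have hp0 : p - 1 ≠ 0 := by linarith
  have e1 : ρ ^ ((2 - p) / (p - 1)) * ρ = ρ ^ (p - 1)⁻¹ := by
    rw [← Real.rpow_add_one hρ.ne']
    congr 1
    field_simp
    ring
  refine ⟨e1, ?_⟩
  rw [pow_two, ← mul_assoc, e1, ← Real.rpow_mul hρ.le, ← Real.rpow_add_one hρ.ne']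
  congr 1
  field_simp
  ring

theorem HS.scale {n : ℕ} {p : ℝ} {u : E n → ℝ} (h : HS n p u) (hp : 1 < p) {ρ : ℝ} (hρ : 0 < ρ)
    {x0 : E n} (hx0 : x0 (Fin.last n) = 0) :
    HS n p (fun z => ρ ^ ((2 - p) / (p - 1)) * u (x0 + ρ • z)) := by
  have hco : ∀ z : E n, (x0 + ρ • z) (Fin.last n) = ρ * z (Fin.last n) := fun z => by simp [hx0]
  have hpos : ∀ z : E n, 0 < z (Fin.last n) → 0 < (x0 + ρ • z) (Fin.last n) := fun z hz => by
    rw [hco]; positivity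
  refine ⟨?_, ?_, ?_, ?_⟩
  · refine continuousOn_const.mul (h.cont.comp (by fun_prop) fun z hz => ?_)
    have hz' : 0 ≤ z (Fin.last n) := hz
    show 0 ≤ (x0 + ρ • z) (Fin.last n)
    rw [hco]; positivity
  · intro z hz
    rw [h.bc _ (by rw [hco, hz, mul_zero]), mul_zero]
  · refine contDiffOn_const.mul (h.cd.comp (by fun_prop) fun z hz => hpos z hz)
  · intro z hz
    have h1 := h.hasGradientAt (hpos z hz)
    rw [(grad_scale (c := ρ ^ ((2 - p) / (p - 1))) h1).gradient]
    exact sol_scale hρ (by positivity) (scale_exp hp hρ).2 (h.sol _ (hpos z hz))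

theorem deriv_nonneg_right {F : ℝ → ℝ} {a : ℝ} (h : HasDerivAt F a 0) (h0 : F 0 = 0)
    (hF : ∀ᶠ s in 𝓝[>] (0:ℝ), 0 ≤ F s) : 0 ≤ a := by
  refine ge_of_tendsto h.tendsto_slope_zero_right ?_
  filter_upwards [hF, self_mem_nhdsWithin] with s hs hs0
  simp only [zero_add, h0, sub_zero, smul_eq_mul]
  have : 0 < s := hs0
  positivity

theorem HasGradientAt.line {n : ℕ} {u : E n → ℝ} {g x : E n} (e : E n) {s : ℝ}
    (h : HasGradientAt u g (x + s • e)) :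
    HasDerivAt (fun s : ℝ => u (x + s • e)) (inner ℝ g e) s := by
  rw [hasGradientAt_iff_hasFDerivAt] at h
  have h1 : HasDerivAt (fun t : ℝ => x + t • e) e s := by
    simpa using ((hasDerivAt_id s).smul_const e).const_add x
  have := h.comp_hasDerivAt s h1
  exact this.congr_deriv (by simp)

/-- The interior gradient bound. -/
theorem grad_bound (n : ℕ) {p : ℝ} (hp : 1 < p) : ∃ C : ℝ, 0 < C ∧ ∀ u : E n → ℝ, HS n p u →
    ∀ x, 0 < x (Fin.last n) → ‖gradient u x‖ ≤ C * x (Fin.last n) ^ (-(p - 1)⁻¹) := by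
  obtain ⟨K, k, hK, hk, H⟩ := grad_unit n hp
  refine ⟨K * 3 ^ (p - 1)⁻¹, by positivity, fun u hu x0 hx0 => ?_⟩
  obtain ⟨ρ, hρ⟩ : ∃ ρ, ρ = x0 (Fin.last n) / 3 := ⟨_, rfl⟩
  have hρ0 : 0 < ρ := by rw [hρ]; positivity
  obtain ⟨c, hc⟩ : ∃ c, c = ρ ^ ((2 - p) / (p - 1)) := ⟨_, rfl⟩
  have hc0 : 0 < c := by rw [hc]; positivity
  have hpos : ∀ z : E n, ‖z‖ ≤ 2 → 0 < (x0 + ρ • z) (Fin.last n) := fun z hz => by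
    have h1 := neg_le_of_abs_le ((abs_coord_le z (Fin.last n)).trans hz)
    have h2 : (x0 + ρ • z) (Fin.last n) = x0 (Fin.last n) + ρ * z (Fin.last n) := by simp
    have h3 : ρ * (-2) ≤ ρ * z (Fin.last n) := by gcongr
    rw [h2]; linarith
  have hcd : ContDiffOn ℝ 2 (fun z : E n => c * u (x0 + ρ • z)) (Metric.closedBall 0 2) := by
    refine contDiffOn_const.mul (hu.cd.comp (by fun_prop) fun z hz => ?_)
    exact hpos z (by simpa using hz)
  obtain ⟨G, hG⟩ := hcd.exists_lipschitzOnWith (by norm_num) (convex_closedBall _ _)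
    (isCompact_closedBall _ _)
  have key := H (fun z => c * u (x0 + ρ • z)) G
    (fun z hz => ⟨_, sol_scale hρ0 hc0 (hc ▸ (scale_exp hp hρ0).2) (hu.sol _ (hpos z hz))⟩)
    hcd.continuousOn (fun x y hx hy => by
      have h1 := hG.dist_le_mul y (by simpa using hy) x (by simpa using hx)
      rw [Real.dist_eq, dist_eq_norm, norm_sub_rev] at h1
      exact (le_abs_self _).trans h1)
  have hg0 := hu.hasGradientAt (hpos 0 (by simp))
  have hgU := grad_scale (c := c) hg0
  obtain ⟨g, hg⟩ : ∃ g, g = (c * ρ) • gradient u (x0 + ρ • (0 : E n)) := ⟨_, rfl⟩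
  rw [← hg] at hgU
  have hgK : ‖g‖ ≤ K := by
    have e1 : (0 : E n) = 0 + (0:ℝ) • (-g) := by simp
    rw [e1] at hgU
    have d1 := HasGradientAt.line (-g) hgU
    have d2 : HasDerivAt (fun s : ℝ => phi k (s * ‖g‖)) (1 * ‖g‖) 0 := by
      have a1 : HasDerivAt (fun s : ℝ => s * ‖g‖) ‖g‖ 0 := by
        simpa using (hasDerivAt_id (0:ℝ)).mul_const ‖g‖
      have a2 : HasDerivAt (phi k) 1 (0 * ‖g‖) := by
        rw [zero_mul]
        have := (D2_phi hk (t := 0) (by norm_num)).hasDerivAt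
        simpa using this
      exact a2.comp 0 a1
    have d3 := (d1.sub_const (c * u (x0 + ρ • (0 : E n)))).add (d2.const_mul K)
    have h3 := deriv_nonneg_right d3 (by simp [phi_zero]) ?_
    · rw [inner_neg_right, real_inner_self_eq_norm_sq] at h3
      rcases (norm_nonneg g).lt_or_eq with h | h
      · by_contra hcon
        push Not at hcon
        nlinarith
      · rw [← h]; exact hK.le
    · have hcs : Tendsto (fun s : ℝ => s * ‖g‖) (𝓝[>] 0) (𝓝 0) := by
        have : Continuous (fun s : ℝ => s * ‖g‖) := by fun_prop
        have := this.tendsto 0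
        rw [zero_mul] at this
        exact this.mono_left nhdsWithin_le_nhds
      filter_upwards [hcs.eventually (gt_mem_nhds one_pos), self_mem_nhdsWithin] with s hs hs0
      have hs0' : 0 < s := hs0
      have e2 : ‖(0:E n) + s • (-g)‖ = s * ‖g‖ := by
        rw [zero_add, norm_smul, norm_neg, Real.norm_of_nonneg hs0'.le]
      have := key ((0:E n) + s • (-g)) (by rw [e2]; exact hs)
      rw [e2] at this
      simp only [Pi.add_apply]
      linarith
  have e3 : c * ρ = ρ ^ (p - 1)⁻¹ := hc ▸ (scale_exp hp hρ0).1
  rw [hg, e3, norm_smul, Real.norm_of_nonneg (by positivity), smul_zero, add_zero] at hgK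
  have e4 : (3 : ℝ) ^ (p - 1)⁻¹ * x0 (Fin.last n) ^ (-(p - 1)⁻¹) = (ρ ^ (p - 1)⁻¹)⁻¹ := by
    rw [hρ, Real.div_rpow hx0.le (by norm_num), Real.rpow_neg hx0.le, inv_div]
    ring
  rw [mul_assoc, e4, ← div_eq_mul_inv, le_div_iff₀ (by positivity)]
  linarith

/-- The gradient bound, as a hypothesis. -/
def GB (n : ℕ) (p C : ℝ) (u : E n → ℝ) : Prop :=
  ∀ x, 0 < x (Fin.last n) → ‖gradient u x‖ ≤ C * x (Fin.last n) ^ (-(p - 1)⁻¹)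

theorem vline {n : ℕ} (x : E n) (s : ℝ) :
    (x + s • bv (Fin.last n) : E n) (Fin.last n) = x (Fin.last n) + s := by
  simp

theorem vert {n : ℕ} {p C : ℝ} {u : E n → ℝ} (hu : HS n p u) (hC : GB n p C u)
    {H : ℝ → ℝ} {x : E n} {τ : ℝ} (hx : 0 ≤ x (Fin.last n)) (hτ : 0 ≤ τ)
    (hHc : ContinuousOn H (Icc (x (Fin.last n)) (x (Fin.last n) + τ)))
    (hH : ∀ t, x (Fin.last n) < t → t < x (Fin.last n) + τ →
      HasDerivAt H (t ^ (-(p - 1)⁻¹)) t) :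
    |u (x + τ • bv (Fin.last n)) - u x| ≤ C * (H (x (Fin.last n) + τ) - H (x (Fin.last n))) := by
  have hd : ∀ s ∈ interior (Icc 0 τ), HasDerivAt (fun s : ℝ => u (x + s • bv (Fin.last n)))
      (inner ℝ (gradient u (x + s • bv (Fin.last n))) (bv (Fin.last n))) s ∧
      |inner ℝ (gradient u (x + s • bv (Fin.last n))) (bv (Fin.last n))| ≤
        C * (x (Fin.last n) + s) ^ (-(p - 1)⁻¹) := by
    intro s hs
    rw [interior_Icc] at hs
    have hpos : 0 < (x + s • bv (Fin.last n) : E n) (Fin.last n) := by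
      rw [vline]; linarith [hs.1]
    refine ⟨HasGradientAt.line _ (hu.hasGradientAt hpos), ?_⟩
    have h1 := hC _ hpos
    rw [vline] at h1
    refine le_trans ?_ h1
    refine (abs_real_inner_le_norm _ _).trans ?_
    simp [bv]
  have hdH : ∀ s ∈ interior (Icc 0 τ), HasDerivAt (fun s : ℝ => C * H (x (Fin.last n) + s))
      (C * (x (Fin.last n) + s) ^ (-(p - 1)⁻¹)) s := by
    intro s hs
    rw [interior_Icc] at hs
    have := (hH (x (Fin.last n) + s) (by linarith [hs.1]) (by linarith [hs.2])).comp_const_add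
      (x (Fin.last n)) s
    exact this.const_mul C
  have hcu : ContinuousOn (fun s : ℝ => u (x + s • bv (Fin.last n))) (Icc 0 τ) := by
    refine hu.cont.comp (by fun_prop) fun s hs => ?_
    show 0 ≤ (x + s • bv (Fin.last n) : E n) (Fin.last n)
    rw [vline]; linarith [hs.1]
  have hcH : ContinuousOn (fun s : ℝ => C * H (x (Fin.last n) + s)) (Icc 0 τ) := by
    refine continuousOn_const.mul (hHc.comp (by fun_prop) fun s hs => ?_)
    exact ⟨by linarith [hs.1], by linarith [hs.2]⟩
  have m1 := monotoneOn_of_hasDerivWithinAt_nonneg (convex_Icc 0 τ) (hcH.sub hcu)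
    (fun s hs => ((hdH s hs).sub (hd s hs).1).hasDerivWithinAt)
    (fun s hs => by linarith [le_of_abs_le (hd s hs).2])
  have m2 := monotoneOn_of_hasDerivWithinAt_nonneg (convex_Icc 0 τ) (hcH.add hcu)
    (fun s hs => ((hdH s hs).add (hd s hs).1).hasDerivWithinAt)
    (fun s hs => by linarith [neg_le_of_abs_le (hd s hs).2])
  have r1 := m1 (left_mem_Icc.2 hτ) (right_mem_Icc.2 hτ) hτ
  have r2 := m2 (left_mem_Icc.2 hτ) (right_mem_Icc.2 hτ) hτ
  simp only [Pi.sub_apply, Pi.add_apply, zero_smul, add_zero] at r1 r2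
  rw [abs_le]
  constructor <;> linarith

theorem horiz {n : ℕ} {p C : ℝ} (hp : 1 < p) (hC0 : 0 ≤ C) {u : E n → ℝ} (hu : HS n p u)
    (hC : GB n p C u) {x y : E n} {a : ℝ} (ha : 0 < a) (hx : a ≤ x (Fin.last n))
    (hy : a ≤ y (Fin.last n)) :
    |u y - u x| ≤ C * a ^ (-(p - 1)⁻¹) * ‖y - x‖ := by
  have hconv : Convex ℝ {z : E n | a ≤ z (Fin.last n)} := by
    intro z hz w hw s t hs ht hst
    have hz' : a ≤ z (Fin.last n) := hz
    have hw' : a ≤ w (Fin.last n) := hw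
    show a ≤ (s • z + t • w) (Fin.last n)
    simp only [PiLp.add_apply, PiLp.smul_apply, smul_eq_mul]
    have : a = s * a + t * a := by rw [← add_mul, hst, one_mul]
    rw [this]; gcongr
  have := hconv.norm_image_sub_le_of_norm_fderiv_le (𝕜 := ℝ) (f := u) (C := C * a ^ (-(p - 1)⁻¹))
    (x := x) (y := y)
    (fun z hz => (hu.contDiffAt (ha.trans_le hz)).differentiableAt (by norm_num)) ?_ hx hy
  · simpa using this
  · intro z hz
    rw [← toDual_gradient, LinearIsometryEquiv.norm_map]
    refine (hC z (ha.trans_le hz)).trans ?_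
    have h1 : 0 < (p - 1)⁻¹ := inv_pos.2 (by linarith)
    have h2 : -(p - 1)⁻¹ ≤ 0 := by linarith
    exact mul_le_mul_of_nonneg_left (Real.rpow_le_rpow_of_nonpos ha hz h2) hC0

end OneDim

namespace OneDim
open Filter Topology Set

theorem ev_small (A B : ℝ) (hB : 0 < B) : ∀ᶠ ε in 𝓝[>] (0:ℝ), ε * A < B := by
  have : Continuous (fun ε : ℝ => ε * A) := by fun_prop
  have h := this.tendsto 0
  rw [zero_mul] at h
  exact (h.mono_left nhdsWithin_le_nhds).eventually (gt_mem_nhds hB)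

theorem pow_ineq {p ξ : ℝ} {k : ℕ} (hp : 1 < p) (hkp : 1 ≤ k * (p - 1)) (hξ1 : 1 ≤ ξ) :
    ξ ^ (k + 1) ≤ (ξ ^ (k + 1)) ^ p ∧ ξ ^ (k + 2) ≤ (ξ ^ (k + 1)) ^ p := by
  constructor
  · exact Real.self_le_rpow_of_one_le (one_le_pow₀ hξ1) hp.le
  · rw [← Real.rpow_natCast, ← Real.rpow_natCast, ← Real.rpow_mul (by linarith)]
    apply Real.rpow_le_rpow_of_exponent_le hξ1
    push_cast
    nlinarith

theorem neg_unit (n : ℕ) {p : ℝ} (hp : 1 < p) : ∃ (K : ℝ) (k : ℕ), 0 < K ∧ 1 ≤ k ∧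
    ∀ U : E n → ℝ, HS n p U → ∀ z : E n, 0 ≤ z (Fin.last n) → ‖z + bv (Fin.last n)‖ < 2 →
      -(K * phi k (‖z + bv (Fin.last n)‖ - 1)) ≤ U z := by
  have hp0 : 0 < p - 1 := by linarith
  obtain ⟨k, hk⟩ := exists_nat_ge (max 1 (1 / (p - 1)))
  have hk1 : 1 ≤ k := by exact_mod_cast (le_max_left _ _).trans hk
  have hkp : 1 ≤ k * (p - 1) := by
    have := (le_max_right _ _).trans hk
    rwa [div_le_iff₀ hp0] at this
  obtain ⟨N, hN⟩ : ∃ N : ℝ, N = n + 1 := ⟨_, rfl⟩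
  have hN0 : 0 < N := by rw [hN]; positivity
  obtain ⟨κ, hκ⟩ : ∃ κ : ℝ, κ = k + 1 + N + 1 := ⟨_, rfl⟩
  have hκ0 : 0 < κ := by rw [hκ]; positivity
  obtain ⟨K, hK⟩ : ∃ K, K = κ ^ (p - 1)⁻¹ := ⟨_, rfl⟩
  have hK0 : 0 < K := by rw [hK]; positivity
  have hKκ : K ^ (p - 1) = κ := by
    rw [hK, ← Real.rpow_mul hκ0.le, inv_mul_cancel₀ hp0.ne', Real.rpow_one]
  have hKp : K ^ p = K * κ := by
    rw [← hKκ, Real.rpow_sub_one hK0.ne']; field_simp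
  refine ⟨K, k, hK0, hk1, ?_⟩
  intro U hU zb hzb0 hzb
  obtain ⟨e, he⟩ : ∃ e : E n, e = bv (Fin.last n) := ⟨_, rfl⟩
  rw [← he] at hzb ⊢
  have hen : ‖e‖ = 1 := by rw [he]; simp [bv]
  have hel : ∀ z : E n, (z + e) (Fin.last n) = z (Fin.last n) + 1 := fun z => by rw [he]; simp
  have hge : ∀ z : E n, 0 ≤ z (Fin.last n) → 1 ≤ ‖z + e‖ := fun z hz => by
    have := abs_coord_le (z + e) (Fin.last n)
    rw [hel] at this
    linarith [le_abs_self (z (Fin.last n) + 1)]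
  have hcompact : ∀ r : ℝ, IsCompact {z : E n | 0 ≤ z (Fin.last n) ∧ ‖z + e‖ ≤ 1 + r} := by
    intro r
    refine Metric.isCompact_of_isClosed_isBounded ?_ ?_
    · exact (isClosed_le continuous_const (continuous_coord _)).inter
        (isClosed_le (f := fun z : E n => ‖z + e‖) (by fun_prop) continuous_const)
    · refine (Metric.isBounded_closedBall (x := -e) (r := 1 + r)).subset ?_
      rintro z ⟨-, hz⟩
      rw [Metric.mem_closedBall, dist_eq_norm, sub_neg_eq_add]
      exact hz
  obtain ⟨M, hM⟩ := (hcompact 1).exists_bound_of_continuousOn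
    (hU.cont.mono fun z hz => hz.1)
  obtain ⟨r, hr1, hr2, hr3, hr4⟩ := phi_large hk1 (M / K + 1) (‖zb + e‖ - 1) (by linarith)
  by_contra hcon
  push Not at hcon
  have hcont : ContinuousOn (fun z : E n => U z + K * phi k (‖z + e‖ - 1))
      {z : E n | 0 ≤ z (Fin.last n) ∧ ‖z + e‖ ≤ 1 + r} := by
    refine (hU.cont.mono fun z hz => hz.1).add (continuousOn_const.mul ?_)
    unfold phi
    refine ContinuousOn.div_const (ContinuousOn.sub (ContinuousOn.pow
        (ContinuousOn.inv₀ (by fun_prop) ?_) k) continuousOn_const) _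
    rintro z ⟨h1, h2⟩
    linarith
  obtain ⟨x, hxS, hxm⟩ := (hcompact r).exists_isMinOn ⟨zb, hzb0, by linarith⟩ hcont
  have hxneg : U x + K * phi k (‖x + e‖ - 1) < 0 := by
    have := hxm (show zb ∈ _ from ⟨hzb0, by linarith⟩)
    simp only [Set.mem_ofPred_eq] at this
    linarith
  have hx1 := hge x hxS.1
  have hxpos : 0 < x (Fin.last n) := by
    refine lt_of_le_of_ne hxS.1 fun h => ?_
    rw [hU.bc x h.symm] at hxneg
    have := phi_nonneg hk1 (t := ‖x + e‖ - 1) (by linarith) (by linarith [hxS.2])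
    have : 0 ≤ K * phi k (‖x + e‖ - 1) := by positivity
    linarith
  have hxr : ‖x + e‖ < 1 + r := by
    refine lt_of_le_of_ne hxS.2 fun h => ?_
    have h1 := hM x ⟨hxS.1, by linarith [hxS.2]⟩
    rw [Real.norm_eq_abs] at h1
    have h2 := neg_le_of_abs_le h1
    have e1 : ‖x + e‖ - 1 = r := by linarith
    rw [e1] at hxneg
    have h3 : K * (M / K + 1) ≤ K * phi k r := by gcongr
    have h4 : K * (M / K + 1) = M + K := by field_simp
    linarith
  obtain ⟨t0, ht0⟩ : ∃ t0, t0 = ‖x + e‖ := ⟨_, rfl⟩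
  rw [← ht0] at hxneg hx1 hxr
  have ht0p : 0 < t0 := by linarith
  obtain ⟨ξ, hξ⟩ : ∃ ξ, ξ = (1 - (t0 - 1))⁻¹ := ⟨_, rfl⟩
  have hξ1 : 1 ≤ ξ := by rw [hξ]; exact (one_le_inv₀ (by linarith)).2 (by linarith)
  obtain ⟨q, hq⟩ : ∃ q : E n → ℝ, q = fun y => (‖y + e‖ ^ 2 / t0 + t0) / 2 - 1 := ⟨_, rfl⟩
  have hqx : q x = t0 - 1 := by rw [hq]; simp only [← ht0]; field_simp; ring
  have hψ : ∀ i, D2 (fun t : ℝ => -(K * phi k (q (x + t • bv i)))) 0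
      ((-(K * ξ ^ (k + 1) / t0) • (x + e)) i)
      (-(K * ((k + 1) * ξ ^ (k + 2) * ((x + e) i / t0) ^ 2 + ξ ^ (k + 1) * (1 / t0)))) := by
    intro i
    have h1 : D2 (fun t : ℝ => q (x + t • bv i)) 0 ((x + e) i / t0) (1 / t0) := by
      refine D2.congr_fun ((D2.quad ((t0 ^ 2 / t0 + t0) / 2 - 1) ((x + e) i / t0) (1 / (2 * t0)) 0).congr
        (by ring) (by field_simp)) fun t => ?_
      rw [hq]
      simp only
      rw [show x + t • bv i + e = (x + e) + t • bv i by abel, sq_line, ← ht0]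
      field_simp
      ring
    have h2 : D2 (phi k) ((fun t : ℝ => q (x + t • bv i)) 0) (ξ ^ (k + 1)) ((k + 1) * ξ ^ (k + 2)) := by
      have : (fun t : ℝ => q (x + t • bv i)) 0 = t0 - 1 := by simp [hqx]
      rw [this, hξ]
      exact D2_phi hk1 (by linarith)
    have h3 := D2.comp (f := fun t : ℝ => q (x + t • bv i)) h2 h1
    refine (h3.const_mul K).neg.congr ?_ ?_
    · simp; ring
    · ring
  have htest := min_test (hU.sol x hxpos) (ψ := fun y => -(K * phi k (q y))) hψ ?_
  · have h1 := htest.2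
    have hn1 : ‖(-(K * ξ ^ (k + 1) / t0) • (x + e))‖ = K * ξ ^ (k + 1) := by
      rw [norm_smul, norm_neg, Real.norm_of_nonneg (by positivity), ← ht0]
      field_simp
    rw [hn1, Real.mul_rpow hK0.le (by positivity), hKp, Finset.sum_neg_distrib, ← Finset.mul_sum,
      Finset.sum_add_distrib, ← Finset.mul_sum] at h1
    have hs : ∑ i, ((x + e) i / t0) ^ 2 = 1 := by
      simp only [div_pow]
      rw [← Finset.sum_div, sum_sq, ← ht0]
      field_simp
    rw [hs] at h1
    simp only [Finset.sum_const, Finset.card_univ, Fintype.card_fin, nsmul_eq_mul] at h1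
    obtain ⟨i1, i2⟩ := pow_ineq hp hkp hξ1
    obtain ⟨F, hF⟩ : ∃ F, F = (ξ ^ (k + 1)) ^ p := ⟨_, rfl⟩
    rw [← hF] at h1 i1 i2
    have hF0 : 0 < F := lt_of_lt_of_le (by positivity) i1
    have j1 : (k + 1 : ℝ) * ξ ^ (k + 2) ≤ (k + 1) * F := by gcongr
    have j2 : N * (ξ ^ (k + 1) * (1 / t0)) ≤ N * (F * 1) := by
      have : 1 / t0 ≤ 1 := by rw [div_le_one ht0p]; exact hx1
      gcongr
    have h2 : K * (κ * F) ≤ K * ((k + 1) * ξ ^ (k + 2) + N * (ξ ^ (k + 1) * (1 / t0))) := by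
      push_cast at h1
      rw [← hN] at h1
      linarith
    have h3 := le_of_mul_le_mul_left h2 hK0
    rw [hκ] at h3
    linarith
  · have hop : IsOpen {z : E n | 0 < z (Fin.last n) ∧ ‖z + e‖ < 1 + r} :=
      (isOpen_lt continuous_const (continuous_coord _)).inter
        (isOpen_lt (f := fun z : E n => ‖z + e‖) (by fun_prop) continuous_const)
    have hqc : ContinuousAt q x := by
      rw [hq]; fun_prop
    have hq1 : ∀ᶠ y in 𝓝 x, q y < 1 := hqc.eventually (gt_mem_nhds (by rw [hqx]; linarith))
    filter_upwards [hop.mem_nhds (x := x) ⟨hxpos, by rw [← ht0]; exact hxr⟩, hq1] with y hy hqy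
    have h1 := hxm (show y ∈ _ from ⟨hy.1.le, hy.2.le⟩)
    simp only [Set.mem_ofPred_eq] at h1
    rw [← ht0] at h1
    have h2 : ‖y + e‖ - 1 ≤ q y := by
      rw [hq]
      simp only
      have : ‖y + e‖ ≤ (‖y + e‖ ^ 2 / t0 + t0) / 2 := by
        rw [le_div_iff₀ (by norm_num), div_add' _ _ _ ht0p.ne', le_div_iff₀ ht0p]
        nlinarith [sq_nonneg (‖y + e‖ - t0)]
      linarith
    have h3 := mul_le_mul_of_nonneg_left (phi_mono (k := k) h2 hqy) hK0.le
    simp only [hqx]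
    linarith

theorem HS.nonneg {n : ℕ} {p : ℝ} (hp : 1 < p) {u : E n → ℝ} (hu : HS n p u) {y : E n}
    (hy : 0 ≤ y (Fin.last n)) : 0 ≤ u y := by
  obtain ⟨K, k, hK, hk, H⟩ := neg_unit n hp
  by_contra hcon
  push Not at hcon
  obtain ⟨s, hs⟩ : ∃ s, s = y (Fin.last n) := ⟨_, rfl⟩
  have hs0 : 0 < s := by
    rw [hs]
    refine lt_of_le_of_ne hy fun h => ?_
    rw [hu.bc y h.symm] at hcon
    exact lt_irrefl _ hcon
  have hα : 0 < (p - 1)⁻¹ := inv_pos.2 (by linarith)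
  have hlim := tendsto_rpow_atTop hα
  obtain ⟨R, hR1, hR2⟩ := ((hlim.eventually (eventually_gt_atTop (K * 2 ^ (k + 1) * s / (-u y)))).and
    (eventually_ge_atTop (2 * s))).exists
  have hR0 : 0 < R := by linarith
  have hx0 : (y - s • bv (Fin.last n) : E n) (Fin.last n) = 0 := by simp [hs]
  have hsc := hu.scale hp hR0 hx0
  have hsR : s / R ≤ 1 / 2 := by rw [div_le_iff₀ hR0]; linarith
  have hsR0 : 0 < s / R := by positivity
  have hz : ‖(s / R) • bv (Fin.last n) + bv (Fin.last n : Fin (n + 1))‖ = s / R + 1 := by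
    have : (s / R) • bv (Fin.last n) + bv (Fin.last n : Fin (n + 1)) = (s / R + 1) • bv (Fin.last n) := by
      rw [add_smul, one_smul]
    rw [this, norm_smul, Real.norm_of_nonneg (by positivity)]
    simp [bv]
  have key := H _ hsc ((s / R) • bv (Fin.last n)) (by simp; positivity) (by rw [hz]; linarith)
  rw [hz, add_sub_cancel_right, smul_smul, mul_div_cancel₀ _ hR0.ne', sub_add_cancel] at key
  have h1 := phi_le hk hsR0.le (by linarith)
  have h2 : (1 - s / R)⁻¹ ≤ 2 := by
    rw [inv_le_comm₀ (by linarith) (by norm_num)]; linarith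
  have h2' : 0 < (1 - s / R)⁻¹ := inv_pos.2 (by linarith)
  have h3 : s / R * (1 - s / R)⁻¹ ^ (k + 1) ≤ s / R * 2 ^ (k + 1) := by gcongr
  have h4 : K * phi k (s / R) ≤ K * (s / R * 2 ^ (k + 1)) := by
    gcongr; linarith
  have e1 := (scale_exp hp hR0).1
  rw [div_lt_iff₀ (by linarith)] at hR1
  have h5 : R * (-(K * (s / R * 2 ^ (k + 1)))) ≤ R * (R ^ ((2 - p) / (p - 1)) * u y) := by
    gcongr; linarith
  have h6 : R * (-(K * (s / R * 2 ^ (k + 1)))) = -(K * 2 ^ (k + 1) * s) := by field_simp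
  have h7 : R * (R ^ ((2 - p) / (p - 1)) * u y) = R ^ (p - 1)⁻¹ * u y := by rw [← e1]; ring
  rw [h6, h7] at h5
  linarith

theorem rpow_lip {p G : ℝ} (hp : 1 < p) : ∃ Λ : ℝ, 0 ≤ Λ ∧ ∀ s t : ℝ, 0 ≤ s → s ≤ G → 0 ≤ t →
    t ≤ G → |s ^ p - t ^ p| ≤ Λ * |s - t| := by
  have h : ContDiff ℝ 1 (fun x : ℝ => x ^ p) :=
    Real.contDiff_rpow_const_of_le (n := 1) (by simpa using hp.le)
  obtain ⟨K, hK⟩ := h.contDiffOn.exists_lipschitzOnWith (s := Icc 0 G) (by norm_num)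
    (convex_Icc _ _) isCompact_Icc
  refine ⟨K, K.2, fun s t h1 h2 h3 h4 => ?_⟩
  have := hK.dist_le_mul s ⟨h1, h2⟩ t ⟨h3, h4⟩
  simpa [Real.dist_eq] using this

theorem D2_exp (κ x : ℝ) : D2 (fun t => Real.exp (κ * t)) x (κ * Real.exp (κ * x))
    (κ ^ 2 * Real.exp (κ * x)) := by
  have h : ∀ x : ℝ, HasDerivAt (fun t => Real.exp (κ * t)) (κ * Real.exp (κ * x)) x := fun x => by
    have := ((hasDerivAt_id x).const_mul κ).exp
    exact this.congr_deriv (by simp; ring)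
  refine ⟨fun t => κ * Real.exp (κ * t), Eventually.of_forall h, rfl, ?_⟩
  exact ((h x).const_mul κ).congr_deriv (by ring)

end OneDim

namespace OneDim
open Filter Topology Set

theorem bv_apply {n : ℕ} (i j : Fin (n + 1)) : (bv j : E n) i = if j = i then 1 else 0 := by
  simp [bv, PiLp.single_apply, eq_comm]

theorem sum_bv {n : ℕ} (j : Fin (n + 1)) : ∑ i, (bv j : E n) i = 1 := by
  simp [bv, PiLp.single_apply]

theorem norm_bv {n : ℕ} (j : Fin (n + 1)) : ‖(bv j : E n)‖ = 1 := by simp [bv]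

theorem D2_coord {n : ℕ} {F : ℝ → ℝ} {x : E n} {A B : ℝ} {j : Fin (n + 1)} (i : Fin (n + 1))
    (h : D2 F (x j) A B) :
    D2 (fun t => F ((x + t • bv i) j)) 0 (A * (bv j : E n) i) (B * (bv j : E n) i) := by
  obtain ⟨ι, hι⟩ : ∃ ι : ℝ, ι = if j = i then 1 else 0 := ⟨_, rfl⟩
  have hsq : ι ^ 2 = ι := by rw [hι]; split_ifs <;> norm_num
  rw [bv_apply, ← hι]
  have h1 : D2 (fun t : ℝ => x j + ι * t + 0 * t ^ 2) 0 ι 0 := (D2.quad _ _ _ _).congr (by ring) (by ring)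
  have h2 : D2 F ((fun t : ℝ => x j + ι * t + 0 * t ^ 2) 0) A B := by simpa using h
  have h3 := D2.comp (f := fun t : ℝ => x j + ι * t + 0 * t ^ 2) h2 h1
  refine D2.congr_fun (h3.congr (by ring) (by rw [hsq]; ring)) fun t => ?_
  rw [coord_line, ← hι]
  simp

theorem D2_sq {n : ℕ} (x : E n) (i : Fin (n + 1)) :
    D2 (fun t => ‖x + t • bv i‖ ^ 2) 0 (2 * x i) 2 := by
  refine D2.congr_fun ((D2.quad (‖x‖ ^ 2) (2 * x i) 1 0).congr (by ring) (by ring)) fun t => ?_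
  rw [sq_line]; ring

set_option maxHeartbeats 1000000 in
theorem strip {n : ℕ} {p C : ℝ} (hp : 1 < p) (hC0 : 0 ≤ C) {u : E n → ℝ} (hu : HS n p u)
    (hC : GB n p C u) {h : E n} (hh : h (Fin.last n) = 0) {a b μ : ℝ} (ha : 0 < a)
    (hwa : ∀ x : E n, x (Fin.last n) = a → u (x + h) - u x ≤ μ)
    (hwb : ∀ x : E n, x (Fin.last n) = b → u (x + h) - u x ≤ μ) {xs : E n}
    (hxa : a ≤ xs (Fin.last n)) (hxb : xs (Fin.last n) ≤ b) : u (xs + h) - u xs ≤ μ := by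
  by_contra hcon
  push Not at hcon
  have hhl : ∀ x : E n, (x + h) (Fin.last n) = x (Fin.last n) := fun x => by simp [hh]
  obtain ⟨G, hG⟩ : ∃ G, G = C * a ^ (-(p - 1)⁻¹) := ⟨_, rfl⟩
  have hα : 0 < (p - 1)⁻¹ := inv_pos.2 (by linarith)
  have hgrad : ∀ x : E n, a ≤ x (Fin.last n) → ‖gradient u x‖ ≤ G := fun x hx => by
    refine (hC x (ha.trans_le hx)).trans ?_
    rw [hG]
    exact mul_le_mul_of_nonneg_left (Real.rpow_le_rpow_of_nonpos ha hx (by linarith)) hC0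
  obtain ⟨W, hW⟩ : ∃ W, W = G * ‖h‖ := ⟨_, rfl⟩
  have hw : ∀ x : E n, a ≤ x (Fin.last n) → u (x + h) - u x ≤ W := fun x hx => by
    have := horiz hp hC0 hu hC ha hx (y := x + h) (by rw [hhl]; exact hx)
    rw [add_sub_cancel_left, ← hG, ← hW] at this
    exact (le_abs_self _).trans this
  obtain ⟨Λ, hΛ0, hΛ⟩ := rpow_lip (G := G) hp
  obtain ⟨κ, hκ⟩ : ∃ κ, κ = Λ + 1 := ⟨_, rfl⟩
  obtain ⟨N, hN⟩ : ∃ N : ℝ, N = n + 1 := ⟨_, rfl⟩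
  obtain ⟨η, hη⟩ : ∃ η, η = u (xs + h) - u xs - μ := ⟨_, rfl⟩
  have hη0 : 0 < η := by rw [hη]; linarith
  obtain ⟨Eb, hEb⟩ : ∃ Eb, Eb = Real.exp (κ * b) := ⟨_, rfl⟩
  have hEb0 : 0 < Eb := by rw [hEb]; exact Real.exp_pos _
  obtain ⟨δ, hδ1, hδ0⟩ := ((ev_small Eb (η / 2) (by linarith)).and self_mem_nhdsWithin).exists
  have hδ0' : 0 < δ := hδ0
  obtain ⟨B, hB⟩ : ∃ B, B = W + δ * Eb - μ := ⟨_, rfl⟩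
  obtain ⟨ε, ⟨⟨hε1, hε2⟩, hε3⟩, hε0⟩ := (((ev_small (‖xs‖ ^ 2) (η / 4) (by linarith)).and
    (ev_small (2 * N) (δ / 2) (by linarith))).and
    (ev_small (4 * Λ ^ 2 * B) ((δ / 2) ^ 2) (by positivity))).and self_mem_nhdsWithin |>.exists
  have hε0' : 0 < ε := hε0
  obtain ⟨R, hR1, hR2, hR3⟩ : ∃ R, ‖xs‖ ≤ R ∧ 1 ≤ R ∧ B < ε * R ^ 2 := by
    refine ⟨max ‖xs‖ (max 1 (B / ε + 1)), le_max_left _ _, (le_max_left _ _).trans (le_max_right _ _), ?_⟩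
    obtain ⟨R, hR⟩ : ∃ R, R = max ‖xs‖ (max 1 (B / ε + 1)) := ⟨_, rfl⟩
    rw [← hR]
    have h1 : 1 ≤ R := by rw [hR]; exact (le_max_left _ _).trans (le_max_right _ _)
    have h2 : B / ε + 1 ≤ R := by rw [hR]; exact (le_max_right _ _).trans (le_max_right _ _)
    have h3 : B / ε < R ^ 2 := by nlinarith
    rw [div_lt_iff₀ hε0'] at h3
    linarith
  have hSc : IsCompact {x : E n | (a ≤ x (Fin.last n) ∧ x (Fin.last n) ≤ b) ∧ ‖x‖ ≤ R} := by
    refine Metric.isCompact_of_isClosed_isBounded ?_ ?_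
    · exact ((isClosed_le continuous_const (continuous_coord _)).inter
        (isClosed_le (continuous_coord _) continuous_const)).inter
        (isClosed_le continuous_norm continuous_const)
    · refine (Metric.isBounded_closedBall (x := (0 : E n)) (r := R)).subset ?_
      rintro z ⟨-, hz⟩
      simpa using hz
  have hcont : ContinuousOn (fun x : E n => u (x + h) - u x -
      (-(δ * Real.exp (κ * x (Fin.last n))) + ε * ‖x‖ ^ 2))
      {x : E n | (a ≤ x (Fin.last n) ∧ x (Fin.last n) ≤ b) ∧ ‖x‖ ≤ R} := by
    refine ((hu.cont.comp (by fun_prop) fun x hx => ?_).sub (hu.cont.mono fun x hx => ?_)).sub ?_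
    · show 0 ≤ (x + h) (Fin.last n)
      rw [hhl]; exact ha.le.trans hx.1.1
    · exact ha.le.trans hx.1.1
    · have := continuous_coord (Fin.last n)
      exact Continuous.continuousOn (by fun_prop)
  obtain ⟨x, ⟨⟨hx1, hx2⟩, hx3⟩, hxm⟩ := hSc.exists_isMaxOn ⟨xs, ⟨hxa, hxb⟩, hR1⟩ hcont
  have hF := hxm (show xs ∈ _ from ⟨⟨hxa, hxb⟩, hR1⟩)
  simp only [Set.mem_ofPred_eq] at hF
  have hEs : 0 < δ * Real.exp (κ * xs (Fin.last n)) := by positivity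
  have hκ0 : 0 < κ := by linarith
  have hEx : Real.exp (κ * x (Fin.last n)) ≤ Eb := by
    rw [hEb]; gcongr
  have hEx' : δ * Real.exp (κ * x (Fin.last n)) ≤ δ * Eb := by gcongr
  have hxsq : ε * ‖x‖ ^ 2 ≤ B := by
    have := hw x hx1
    linarith
  have hxs2 : 0 ≤ ε * ‖x‖ ^ 2 := by positivity
  have hxR : ‖x‖ < R := by
    refine lt_of_le_of_ne hx3 fun h => ?_
    rw [h] at hxsq; linarith
  have hxa' : a < x (Fin.last n) := by
    refine lt_of_le_of_ne hx1 fun h => ?_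
    have := hwa x h.symm
    linarith
  have hxb' : x (Fin.last n) < b := by
    refine lt_of_le_of_ne hx2 fun h => ?_
    have := hwb x h
    linarith
  obtain ⟨X, hX⟩ : ∃ X, X = Real.exp (κ * x (Fin.last n)) := ⟨_, rfl⟩
  have hψ : ∀ i, D2 (fun t : ℝ => (fun y : E n => -(δ * Real.exp (κ * y (Fin.last n))) + ε * ‖y‖ ^ 2)
      (x + t • bv i)) 0 ((-(δ * (κ * X)) • bv (Fin.last n) + (2 * ε) • x) i)
      (-(δ * (κ ^ 2 * X)) * (bv (Fin.last n) : E n) i + 2 * ε) := by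
    intro i
    have h1 := D2_coord (x := x) i (((D2_exp κ (x (Fin.last n))).const_mul δ).neg)
    rw [← hX] at h1
    refine ((h1.add ((D2_sq x i).const_mul ε)).congr ?_ ?_)
    · simp only [PiLp.add_apply, PiLp.smul_apply, smul_eq_mul]; ring
    · ring
  have hsol2 : Sol p (fun y => u (y + h)) x (gradient u (x + h)) := by
    obtain ⟨b', hb1, hb2⟩ := hu.sol (x + h) (by rw [hhl]; linarith)
    refine ⟨b', fun i => (hb1 i).congr_fun fun t => ?_, hb2⟩
    rw [add_right_comm]
  have hxp : 0 < x (Fin.last n) := by linarith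
  have htest := diff_test (ψ := fun y : E n => -(δ * Real.exp (κ * y (Fin.last n))) + ε * ‖y‖ ^ 2)
    hsol2 (hu.sol x hxp) hψ ?_
  · obtain ⟨t1, t2⟩ := htest
    have hn : ‖-(δ * (κ * X)) • bv (Fin.last n) + (2 * ε) • x‖ ≤ δ * (κ * X) + 2 * ε * ‖x‖ := by
      refine (norm_add_le _ _).trans ?_
      have hX0 : 0 < X := by rw [hX]; positivity
      rw [norm_smul, norm_smul, norm_neg, Real.norm_of_nonneg (by positivity),
        Real.norm_of_nonneg (by positivity), norm_bv, mul_one]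
    have hl := hΛ ‖gradient u x‖ ‖gradient u (x + h)‖ (norm_nonneg _) (hgrad _ hx1) (norm_nonneg _)
      (hgrad _ (by rw [hhl]; exact hx1))
    have hl2 : |‖gradient u x‖ - ‖gradient u (x + h)‖| ≤ δ * (κ * X) + 2 * ε * ‖x‖ := by
      refine (abs_norm_sub_norm_le _ _).trans ?_
      rw [norm_sub_rev, t1]; exact hn
    have hl3 := neg_le_of_abs_le (hl.trans (mul_le_mul_of_nonneg_left hl2 hΛ0))
    rw [Finset.sum_add_distrib, ← Finset.mul_sum, sum_bv] at t2
    simp only [Finset.sum_const, Finset.card_univ, Fintype.card_fin, nsmul_eq_mul] at t2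
    push_cast at t2
    rw [← hN] at t2
    have hX1 : 1 ≤ X := by
      rw [hX]; exact Real.one_le_exp (by positivity)
    have hkk : δ * (κ ^ 2 * X) - Λ * (δ * (κ * X)) = δ * (κ * X) := by rw [hκ]; ring
    have hkX : δ * 1 ≤ δ * (κ * X) := by
      have : 1 ≤ κ * X := by
        have : 1 ≤ κ := by linarith
        nlinarith
      gcongr
    have hlt : δ / 2 < 2 * Λ * (ε * ‖x‖) := by linarith
    have hsq : (δ / 2) ^ 2 < (2 * Λ * (ε * ‖x‖)) ^ 2 := by
      gcongr
    have h4 : (2 * Λ * (ε * ‖x‖)) ^ 2 = ε * (4 * Λ ^ 2 * (ε * ‖x‖ ^ 2)) := by ring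
    have h5 : ε * (4 * Λ ^ 2 * (ε * ‖x‖ ^ 2)) ≤ ε * (4 * Λ ^ 2 * B) := by gcongr
    linarith
  · have hop : IsOpen {x : E n | (a < x (Fin.last n) ∧ x (Fin.last n) < b) ∧ ‖x‖ < R} :=
      ((isOpen_lt continuous_const (continuous_coord _)).inter
        (isOpen_lt (continuous_coord _) continuous_const)).inter
        (isOpen_lt continuous_norm continuous_const)
    filter_upwards [hop.mem_nhds (x := x) ⟨⟨hxa', hxb'⟩, hxR⟩] with y hy
    exact hxm (show y ∈ _ from ⟨⟨hy.1.1.le, hy.1.2.le⟩, hy.2.le⟩)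

/-- Uniform vanishing at the boundary. -/
def UV (n : ℕ) (u : E n → ℝ) : Prop :=
  ∀ η : ℝ, 0 < η → ∃ a, 0 < a ∧ ∀ x : E n, 0 ≤ x (Fin.last n) → x (Fin.last n) ≤ a → u x ≤ η

theorem conclude_le {n : ℕ} {p : ℝ} (hp : 1 < p) {u : E n → ℝ} (hu : HS n p u) (hv : UV n u)
    {h x : E n} (hh : h (Fin.last n) = 0) (hx : 0 < x (Fin.last n)) : u (x + h) ≤ u x := by
  obtain ⟨C, hC0, hC⟩ := grad_bound n hp
  refine le_of_forall_pos_le_add fun η hη => ?_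
  obtain ⟨a0, ha0, ha⟩ := hv η hη
  have hα : 0 < (p - 1)⁻¹ := inv_pos.2 (by linarith)
  have hlim : Tendsto (fun b : ℝ => C * b ^ (-(p - 1)⁻¹) * ‖h‖) atTop (𝓝 0) := by
    simpa using ((tendsto_rpow_neg_atTop hα).const_mul C).mul_const ‖h‖
  obtain ⟨b, hb1, hb2⟩ := ((hlim.eventually (gt_mem_nhds hη)).and
    (eventually_ge_atTop (x (Fin.last n)))).exists
  have hb0 : 0 < b := by linarith
  have hhl : ∀ x : E n, (x + h) (Fin.last n) = x (Fin.last n) := fun x => by simp [hh]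
  have := strip hp hC0.le hu (hC u hu) hh (a := min a0 (x (Fin.last n))) (b := b) (μ := η) (xs := x)
    (lt_min ha0 hx) ?_ ?_ (min_le_right _ _) hb2
  · linarith
  · intro y hy
    have hy0 : 0 ≤ y (Fin.last n) := by rw [hy]; exact (lt_min ha0 hx).le
    have h1 := ha (y + h) (by rw [hhl]; exact hy0) (by rw [hhl, hy]; exact min_le_left _ _)
    have h2 := hu.nonneg hp hy0
    linarith
  · intro y hy
    have := horiz hp hC0.le hu (hC u hu) hb0 (x := y) (y := y + h) hy.ge (by rw [hhl]; exact hy.ge)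
    rw [add_sub_cancel_left] at this
    exact (le_abs_self _).trans (this.trans hb1.le)

theorem conclude {n : ℕ} {p : ℝ} (hp : 1 < p) {u : E n → ℝ} (hu : HS n p u) (hv : UV n u)
    {x y : E n} (hx : 0 ≤ x (Fin.last n)) (hxy : x (Fin.last n) = y (Fin.last n)) : u x = u y := by
  rcases hx.lt_or_eq with h | h
  · have h1 := conclude_le hp hu hv (h := y - x) (x := x) (by simp [hxy]) h
    have h2 := conclude_le hp hu hv (h := x - y) (x := y) (by simp [hxy]) (hxy ▸ h)
    rw [add_sub_cancel] at h1 h2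
    exact le_antisymm h2 h1
  · rw [hu.bc x h.symm, hu.bc y (by rw [← hxy]; exact h.symm)]

end OneDim

namespace OneDim
open Filter Topology Set

theorem proj_zero {n : ℕ} (x : E n) :
    (x - x (Fin.last n) • bv (Fin.last n) : E n) (Fin.last n) = 0 := by simp

/-- The case `p > 2`. -/
theorem uv_super {n : ℕ} {p : ℝ} (hp : 2 < p) {u : E n → ℝ} (hu : HS n p u) : UV n u := by
  obtain ⟨C, hC0, hC⟩ := grad_bound n (p := p) (by linarith)
  obtain ⟨α, hα⟩ : ∃ α, α = (p - 1)⁻¹ := ⟨_, rfl⟩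
  have hα1 : α < 1 := by rw [hα]; exact inv_lt_one_of_one_lt₀ (by linarith)
  have h1α : 0 < 1 - α := by linarith
  have hcH : Continuous (fun t : ℝ => t ^ (1 - α) / (1 - α)) :=
    (Real.continuous_rpow_const h1α.le).div_const _
  have hb : ∀ x : E n, 0 ≤ x (Fin.last n) → u x ≤ C * (x (Fin.last n) ^ (1 - α) / (1 - α)) := by
    intro x hx
    have hy := proj_zero x
    have := vert hu (hC u hu) (H := fun t : ℝ => t ^ (1 - α) / (1 - α)) (τ := x (Fin.last n))
      hy.ge hx hcH.continuousOn ?_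
    · rw [hy, sub_add_cancel, hu.bc _ hy, sub_zero, zero_add, Real.zero_rpow h1α.ne'] at this
      simpa using (le_abs_self _).trans this
    · intro t ht _
      rw [hy] at ht
      have := (Real.hasDerivAt_rpow_const (x := t) (p := 1 - α) (Or.inl ht.ne')).div_const (1 - α)
      refine this.congr_deriv ?_
      rw [← hα, mul_div_cancel_left₀ _ h1α.ne']
      congr 1; ring
  intro η hη
  have hlim : Tendsto (fun t : ℝ => C * (t ^ (1 - α) / (1 - α))) (𝓝[>] 0) (𝓝 0) := by
    have : Tendsto (fun t : ℝ => C * (t ^ (1 - α) / (1 - α))) (𝓝 0)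
        (𝓝 (C * ((0 : ℝ) ^ (1 - α) / (1 - α)))) := (continuous_const.mul hcH).tendsto 0
    have h0 : C * ((0 : ℝ) ^ (1 - α) / (1 - α)) = 0 := by rw [Real.zero_rpow h1α.ne']; simp
    rw [h0] at this
    exact this.mono_left nhdsWithin_le_nhds
  obtain ⟨a, ha1, ha0⟩ := ((hlim.eventually (gt_mem_nhds hη)).and self_mem_nhdsWithin).exists
  refine ⟨a, ha0, fun x hx0 hxa => (hb x hx0).trans (le_trans ?_ ha1.le)⟩
  gcongr

/-- One-dimensional barrier. -/
noncomputable def bar (a c β t : ℝ) : ℝ := a / β * (c ^ (-β) - (t + c) ^ (-β))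

theorem hasDerivAt_shift_rpow {c t : ℝ} (q : ℝ) (h : 0 < t + c) :
    HasDerivAt (fun t : ℝ => (t + c) ^ q) (q * (t + c) ^ (q - 1)) t :=
  (Real.hasDerivAt_rpow_const (x := t + c) (p := q) (Or.inl h.ne')).comp_add_const t c

theorem D2_bar {a c β t : ℝ} (hβ : 0 < β) (h : 0 < t + c) :
    D2 (bar a c β) t (a * (t + c) ^ (-β - 1)) (-(a * (β + 1) * (t + c) ^ (-β - 1 - 1))) := by
  have h1 : ∀ s, 0 < s + c → HasDerivAt (bar a c β) (a * (s + c) ^ (-β - 1)) s := fun s hs => by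
    have := ((hasDerivAt_const s (c ^ (-β))).sub (hasDerivAt_shift_rpow (-β) hs)).const_mul (a / β)
    refine this.congr_deriv ?_
    field_simp
    ring
  refine ⟨fun s => a * (s + c) ^ (-β - 1), ?_, rfl, ?_⟩
  · have : IsOpen {s : ℝ | 0 < s + c} := isOpen_lt continuous_const (by fun_prop)
    filter_upwards [this.mem_nhds h] with s hs using h1 s hs
  · exact ((hasDerivAt_shift_rpow (-β - 1) h).const_mul a).congr_deriv (by ring)

theorem bar_mono {a c β s t : ℝ} (ha : 0 < a) (hβ : 0 < β) (hc : 0 < c) (hs : 0 ≤ s) (hst : s ≤ t) :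
    bar a c β s ≤ bar a c β t := by
  unfold bar
  have : (t + c) ^ (-β) ≤ (s + c) ^ (-β) :=
    Real.rpow_le_rpow_of_nonpos (by linarith) (by linarith) (by linarith)
  gcongr

theorem bar_zero (a c β : ℝ) : bar a c β 0 = 0 := by simp [bar]

theorem bar_continuousOn (a : ℝ) {c β : ℝ} (hc : 0 < c) : ContinuousOn (bar a c β) (Ici 0) := by
  unfold bar
  refine continuousOn_const.mul (continuousOn_const.sub ?_)
  refine ContinuousOn.rpow_const (by fun_prop) fun t ht => Or.inl ?_
  have : 0 ≤ t := ht
  positivity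

/-- Compactness of half-balls cut at height `L`. -/
theorem compact_slab {n : ℕ} (L K : ℝ) :
    IsCompact {z : E n | (0 ≤ z (Fin.last n) ∧ z (Fin.last n) ≤ L) ∧ ‖z‖ ≤ K} := by
  refine Metric.isCompact_of_isClosed_isBounded ?_ ?_
  · exact ((isClosed_le continuous_const (continuous_coord _)).inter
      (isClosed_le (continuous_coord _) continuous_const)).inter
      (isClosed_le continuous_norm continuous_const)
  · refine (Metric.isBounded_closedBall (x := (0 : E n)) (r := K)).subset ?_
    rintro z ⟨-, hz⟩
    simpa using hz

theorem open_slab {n : ℕ} (L K : ℝ) :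
    IsOpen {z : E n | (0 < z (Fin.last n) ∧ z (Fin.last n) < L) ∧ ‖z‖ < K} :=
  ((isOpen_lt continuous_const (continuous_coord _)).inter
    (isOpen_lt (continuous_coord _) continuous_const)).inter
    (isOpen_lt continuous_norm continuous_const)

theorem barrier_sub (n : ℕ) {p : ℝ} (hp : 1 < p) {a β c L D : ℝ} (hβ : β = (2 - p) / (p - 1))
    (hβ0 : 0 < β) (ha0 : 0 < a) (ha : a ^ p = a * (β + 1) / 2) (hc : 0 < c) (hL : 0 < L)
    (hD : 0 ≤ D) :
    ∃ K0 : ℝ, 1 ≤ K0 ∧ ∀ K, K0 ≤ K → ∀ U : E n → ℝ, HS n p U →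
      (∀ z : E n, z (Fin.last n) = L → ‖z‖ ≤ K → U z ≤ bar a c β L) →
      (∀ z : E n, 0 ≤ z (Fin.last n) → z (Fin.last n) ≤ L → ‖z‖ ≤ K → U z ≤ D) →
      ∀ z : E n, 0 ≤ z (Fin.last n) → z (Fin.last n) ≤ L → ‖z‖ ≤ K →
        U z ≤ bar a c β (z (Fin.last n)) + D / K ^ 2 * ‖z‖ ^ 2 := by
  obtain ⟨N, hN⟩ : ∃ N : ℝ, N = n + 1 := ⟨_, rfl⟩
  have hN0 : 0 < N := by rw [hN]; positivity
  obtain ⟨m, hm⟩ : ∃ m, m = a * (L + c) ^ (-β - 1) := ⟨_, rfl⟩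
  obtain ⟨M, hM⟩ : ∃ M, M = a * c ^ (-β - 1) := ⟨_, rfl⟩
  have hm0 : 0 < m := by rw [hm]; positivity
  obtain ⟨Λ, hΛ0, hΛ⟩ := rpow_lip (G := M + 1) hp
  have hmp : 0 < m ^ p := by positivity
  refine ⟨max 1 (max (2 * D) ((2 * Λ * D + 2 * D * N) / m ^ p + 1)), le_max_left _ _, ?_⟩
  intro K hK U hU hUL hUD zb hz0 hzL hzK
  have hK1 : 1 ≤ K := (le_max_left _ _).trans hK
  have hK2 : 2 * D ≤ K := ((le_max_left _ _).trans (le_max_right _ _)).trans hK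
  have hK3 : (2 * Λ * D + 2 * D * N) / m ^ p + 1 ≤ K :=
    ((le_max_right _ _).trans (le_max_right _ _)).trans hK
  have hK0 : 0 < K := by linarith
  have hK4 : 2 * Λ * D + 2 * D * N < K * m ^ p := by
    have : (2 * Λ * D + 2 * D * N) / m ^ p < K := by linarith
    rwa [div_lt_iff₀ hmp] at this
  by_contra hcon
  push Not at hcon
  have hcont : ContinuousOn (fun z : E n => U z - (bar a c β (z (Fin.last n)) + D / K ^ 2 * ‖z‖ ^ 2))
      {z : E n | (0 ≤ z (Fin.last n) ∧ z (Fin.last n) ≤ L) ∧ ‖z‖ ≤ K} := by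
    refine (hU.cont.mono fun z hz => hz.1.1).sub (ContinuousOn.add ?_ (by fun_prop))
    exact (bar_continuousOn a hc).comp (continuous_coord _).continuousOn fun z hz => hz.1.1
  obtain ⟨x, ⟨⟨hx0, hxL⟩, hxK⟩, hxm⟩ := (compact_slab L K).exists_isMaxOn ⟨zb, ⟨hz0, hzL⟩, hzK⟩ hcont
  have hpos : 0 < U x - (bar a c β (x (Fin.last n)) + D / K ^ 2 * ‖x‖ ^ 2) := by
    have := hxm (show zb ∈ _ from ⟨⟨hz0, hzL⟩, hzK⟩)
    simp only [Set.mem_ofPred_eq] at this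
    linarith
  have hDx : 0 ≤ D / K ^ 2 * ‖x‖ ^ 2 := by positivity
  have hbx : 0 ≤ bar a c β (x (Fin.last n)) := by
    have := bar_mono ha0 hβ0 hc le_rfl hx0
    rwa [bar_zero] at this
  have hx0' : 0 < x (Fin.last n) := by
    refine lt_of_le_of_ne hx0 fun h => ?_
    have := hU.bc x h.symm
    linarith
  have hxL' : x (Fin.last n) < L := by
    refine lt_of_le_of_ne hxL fun h => ?_
    have := hUL x h hxK
    rw [h] at hpos
    linarith
  have hxK' : ‖x‖ < K := by
    refine lt_of_le_of_ne hxK fun h => ?_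
    have := hUD x hx0 hxL hxK
    rw [h] at hpos
    have e : D / K ^ 2 * K ^ 2 = D := by field_simp
    linarith
  obtain ⟨s, hs⟩ : ∃ s, s = x (Fin.last n) := ⟨_, rfl⟩
  rw [← hs] at hx0' hxL'
  obtain ⟨b1, hb1⟩ : ∃ b1, b1 = a * (s + c) ^ (-β - 1) := ⟨_, rfl⟩
  have hsc : 0 < s + c := by linarith
  have hb10 : 0 < b1 := by rw [hb1]; positivity
  have hb1m : m ≤ b1 := by
    rw [hb1, hm]
    refine mul_le_mul_of_nonneg_left ?_ ha0.le
    exact Real.rpow_le_rpow_of_nonpos hsc (by linarith) (by linarith)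
  have hb1M : b1 ≤ M := by
    rw [hb1, hM]
    refine mul_le_mul_of_nonneg_left ?_ ha0.le
    exact Real.rpow_le_rpow_of_nonpos hc (by linarith) (by linarith)
  have hb1p : b1 ^ p = a * (β + 1) / 2 * (s + c) ^ (-β - 1 - 1) := by
    rw [hb1, Real.mul_rpow ha0.le (by positivity), ha, ← Real.rpow_mul hsc.le]
    congr 2
    have : p - 1 ≠ 0 := by linarith
    rw [hβ]; field_simp; ring
  have hψ : ∀ i, D2 (fun t : ℝ => (fun z : E n => bar a c β (z (Fin.last n)) + D / K ^ 2 * ‖z‖ ^ 2)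
      (x + t • bv i)) 0 ((b1 • bv (Fin.last n) + (D / K ^ 2 * 2) • x) i)
      (-(2 * b1 ^ p) * (bv (Fin.last n) : E n) i + D / K ^ 2 * 2) := by
    intro i
    have h1 := D2_coord (x := x) (j := Fin.last n) i (D2_bar (a := a) (c := c) hβ0 (hs ▸ hsc))
    rw [← hs, ← hb1] at h1
    refine (h1.add ((D2_sq x i).const_mul (D / K ^ 2))).congr ?_ ?_
    · simp only [PiLp.add_apply, PiLp.smul_apply, smul_eq_mul]; ring
    · rw [hb1p]; ring
  have htest := max_test (ψ := fun z : E n => bar a c β (z (Fin.last n)) + D / K ^ 2 * ‖z‖ ^ 2)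
    (hU.sol x (hs ▸ hx0')) hψ ?_
  · have t2 := htest.2
    rw [Finset.sum_add_distrib, ← Finset.mul_sum, sum_bv] at t2
    simp only [Finset.sum_const, Finset.card_univ, Fintype.card_fin, nsmul_eq_mul] at t2
    push_cast at t2
    rw [← hN] at t2
    obtain ⟨ε, hε⟩ : ∃ ε, ε = 2 * D / K := ⟨_, rfl⟩
    have hε0 : 0 ≤ ε := by rw [hε]; positivity
    have hε1 : ε ≤ 1 := by rw [hε, div_le_one hK0]; exact hK2
    have hn : ‖b1 • bv (Fin.last n) + (D / K ^ 2 * 2) • x‖ ≤ b1 + ε := by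
      refine (norm_add_le _ _).trans ?_
      rw [norm_smul, norm_smul, Real.norm_of_nonneg hb10.le, Real.norm_of_nonneg (by positivity),
        norm_bv, mul_one]
      have h1 : D / K ^ 2 * 2 * ‖x‖ ≤ D / K ^ 2 * 2 * K := by gcongr
      have h2 : D / K ^ 2 * 2 * K = ε := by rw [hε]; field_simp
      linarith
    have h3 := Real.rpow_le_rpow (norm_nonneg _) hn (show 0 ≤ p by linarith)
    have h4 := hΛ (b1 + ε) b1 (by linarith) (by linarith) hb10.le (by linarith)
    rw [add_sub_cancel_left, abs_of_nonneg hε0] at h4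
    have h5 := (le_abs_self _).trans h4
    have h6 : m ^ p ≤ b1 ^ p := Real.rpow_le_rpow hm0.le hb1m (by linarith)
    have h7 : N * (D / K ^ 2 * 2) ≤ 2 * D * N / K := by
      have : D / K ^ 2 ≤ D / K := by
        gcongr
        nlinarith
      calc N * (D / K ^ 2 * 2) ≤ N * (D / K * 2) := by gcongr
        _ = _ := by ring
    have h8 : m ^ p ≤ (2 * Λ * D + 2 * D * N) / K := by
      have : (2 * Λ * D + 2 * D * N) / K = Λ * ε + 2 * D * N / K := by rw [hε]; ring
      rw [this]; linarith
    rw [le_div_iff₀ hK0] at h8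
    linarith
  · filter_upwards [(open_slab L K).mem_nhds (x := x) ⟨⟨hs ▸ hx0', hs ▸ hxL'⟩, hxK'⟩] with y hy
    exact hxm (show y ∈ _ from ⟨⟨hy.1.1.le, hy.1.2.le⟩, hy.2.le⟩)

end OneDim

namespace OneDim
open Filter Topology Set

theorem vert_sub {n : ℕ} {p C β : ℝ} (hβ : β + 1 = (p - 1)⁻¹) (hβ0 : 0 < β) {u : E n → ℝ}
    (hu : HS n p u) (hC : GB n p C u) {x : E n} {τ : ℝ} (hx : 0 < x (Fin.last n)) (hτ : 0 ≤ τ) :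
    |u (x + τ • bv (Fin.last n)) - u x| ≤
      C / β * (x (Fin.last n) ^ (-β) - (x (Fin.last n) + τ) ^ (-β)) := by
  have h1 : ∀ t : ℝ, 0 < t → HasDerivAt (fun t : ℝ => -(t ^ (-β) / β)) (t ^ (-(p - 1)⁻¹)) t := by
    intro t ht
    have := ((Real.hasDerivAt_rpow_const (x := t) (p := -β) (Or.inl ht.ne')).div_const β).neg
    refine this.congr_deriv ?_
    rw [← hβ, show -β - 1 = -(β + 1) by ring]
    field_simp
  have := vert hu hC (H := fun t : ℝ => -(t ^ (-β) / β)) (τ := τ) hx.le hτ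
    (fun t ht => (h1 t (hx.trans_le ht.1)).continuousAt.continuousWithinAt)
    (fun t ht _ => h1 t (hx.trans ht))
  refine this.trans (le_of_eq ?_)
  ring

theorem growth_sub {n : ℕ} {p C β : ℝ} (hp : 1 < p) (hβ : β + 1 = (p - 1)⁻¹) (hβ0 : 0 < β)
    (hC0 : 0 < C) {u : E n → ℝ} (hu : HS n p u) (hC : GB n p C u) {x : E n}
    (hx : 0 < x (Fin.last n)) :
    u x ≤ u (bv (Fin.last n)) + C / β + C / β * x (Fin.last n) ^ (-β) := by
  have he : (bv (Fin.last n) : E n) (Fin.last n) = 1 := by simp [bv_apply]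
  obtain ⟨d, hd⟩ : ∃ d, d = ‖x - x (Fin.last n) • bv (Fin.last n)‖ := ⟨_, rfl⟩
  have key : ∀ᶠ T : ℝ in atTop, u x ≤ u (bv (Fin.last n)) + C / β + C / β * x (Fin.last n) ^ (-β)
      + C * T ^ (-(p - 1)⁻¹) * d := by
    filter_upwards [eventually_ge_atTop 1, eventually_ge_atTop (x (Fin.last n))] with T h1 h2
    have v1 := vert_sub hβ hβ0 hu hC (τ := T - x (Fin.last n)) hx (by linarith)
    have v2 := vert_sub hβ hβ0 hu hC (x := bv (Fin.last n)) (τ := T - 1) (by rw [he]; norm_num)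
      (by linarith)
    have v3 := horiz hp hC0.le hu hC (x := x + (T - x (Fin.last n)) • bv (Fin.last n))
      (y := bv (Fin.last n) + (T - 1) • bv (Fin.last n)) (a := T) (by linarith)
      (by rw [vline]; linarith) (by rw [vline, he]; linarith)
    rw [show bv (Fin.last n) + (T - 1) • bv (Fin.last n) -
      (x + (T - x (Fin.last n)) • bv (Fin.last n)) = -(x - x (Fin.last n) • bv (Fin.last n)) by
        module, norm_neg, ← hd] at v3
    rw [he, Real.one_rpow] at v2
    have w1 := neg_le_of_abs_le v1
    have w2 := le_of_abs_le v2
    have w3 := neg_le_of_abs_le v3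
    have c0 : 0 ≤ C / β := by positivity
    have q1 : 0 ≤ C / β * (x (Fin.last n) + (T - x (Fin.last n))) ^ (-β) :=
      mul_nonneg c0 (Real.rpow_nonneg (by linarith) _)
    have q2 : 0 ≤ C / β * (1 + (T - 1)) ^ (-β) :=
      mul_nonneg c0 (Real.rpow_nonneg (by linarith) _)
    rw [mul_sub] at w1 w2
    linarith
  have hlim : Tendsto (fun T : ℝ => u (bv (Fin.last n)) + C / β + C / β * x (Fin.last n) ^ (-β)
      + C * T ^ (-(p - 1)⁻¹) * d) atTop (𝓝 (u (bv (Fin.last n)) + C / β +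
        C / β * x (Fin.last n) ^ (-β) + C * 0 * d)) :=
    tendsto_const_nhds.add (((tendsto_rpow_neg_atTop (inv_pos.2 (by linarith))).const_mul C).mul_const d)
  have := ge_of_tendsto hlim key
  simpa using this

end OneDim

namespace OneDim
open Filter Topology Set

/-- Weighted maximum point selection. -/
theorem doubling {n : ℕ} {F : E n → ℝ} (hF : ContinuousOn F {x | 0 ≤ x (Fin.last n)})
    {κ : ℝ} (hκ : 0 < κ) {y0 : E n} (hy0 : 0 ≤ y0 (Fin.last n)) (hpos : 0 < F y0) :
    ∃ (y : E n) (ρ : ℝ), 0 ≤ y (Fin.last n) ∧ ‖y - y0‖ ≤ 1 ∧ 0 < ρ ∧ ρ ≤ 1 ∧ F y0 ≤ F y * ρ ^ κ ∧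
      ∀ x : E n, 0 ≤ x (Fin.last n) → ‖x - y‖ ≤ ρ / 2 → F x ≤ 2 ^ κ * F y := by
  have hc : IsCompact {z : E n | 0 ≤ z (Fin.last n) ∧ ‖z - y0‖ ≤ 1} := by
    refine Metric.isCompact_of_isClosed_isBounded ?_ ?_
    · exact (isClosed_le continuous_const (continuous_coord _)).inter
        (isClosed_le (continuous_id.sub continuous_const).norm continuous_const)
    · refine (Metric.isBounded_closedBall (x := y0) (r := 1)).subset ?_
      rintro z ⟨-, hz⟩
      simpa [dist_eq_norm] using hz
  have hcont : ContinuousOn (fun z : E n => F z * (1 - ‖z - y0‖) ^ κ)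
      {z : E n | 0 ≤ z (Fin.last n) ∧ ‖z - y0‖ ≤ 1} := by
    refine (hF.mono fun z hz => hz.1).mul ?_
    exact ((Real.continuous_rpow_const hκ.le).comp (by fun_prop)).continuousOn
  obtain ⟨y, ⟨hy1, hy2⟩, hym⟩ := hc.exists_isMaxOn ⟨y0, hy0, by simp⟩ hcont
  have hm : ∀ x : E n, 0 ≤ x (Fin.last n) → ‖x - y0‖ ≤ 1 →
      F x * (1 - ‖x - y0‖) ^ κ ≤ F y * (1 - ‖y - y0‖) ^ κ := fun x h1 h2 =>
    hym (show x ∈ _ from ⟨h1, h2⟩)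
  have h0 := hm y0 hy0 (by simp)
  simp only [sub_self, norm_zero, sub_zero, Real.one_rpow, mul_one] at h0
  have hρ : 0 < 1 - ‖y - y0‖ := by
    refine lt_of_le_of_ne (by linarith) fun h => ?_
    rw [← h, Real.zero_rpow hκ.ne', mul_zero] at h0
    linarith
  refine ⟨y, 1 - ‖y - y0‖, hy1, hy2, hρ, by linarith [norm_nonneg (y - y0)], h0, ?_⟩
  have hFy : 0 < F y := by
    by_contra hcon
    push Not at hcon
    have := mul_nonpos_of_nonpos_of_nonneg hcon (Real.rpow_nonneg hρ.le κ)
    linarith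
  intro x hx hxy
  rcases le_or_gt (F x) 0 with h | h
  · exact h.trans (by positivity)
  have e1 : ‖x - y0‖ ≤ ‖x - y‖ + ‖y - y0‖ := norm_sub_le_norm_sub_add_norm_sub _ _ _
  have e2 := hm x hx (by linarith)
  have e3 : ((1 - ‖y - y0‖) / 2) ^ κ ≤ (1 - ‖x - y0‖) ^ κ :=
    Real.rpow_le_rpow (by linarith) (by linarith) hκ.le
  rw [Real.div_rpow hρ.le (by norm_num)] at e3
  have e4 : F x * ((1 - ‖y - y0‖) ^ κ / 2 ^ κ) ≤ F y * (1 - ‖y - y0‖) ^ κ :=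
    (mul_le_mul_of_nonneg_left e3 h.le).trans e2
  have e5 : 0 < (1 - ‖y - y0‖) ^ κ := by positivity
  have e6 : (0:ℝ) < 2 ^ κ := by positivity
  rw [← mul_div_assoc, div_le_iff₀ e6] at e4
  have : F x * (1 - ‖y - y0‖) ^ κ ≤ (2 ^ κ * F y) * (1 - ‖y - y0‖) ^ κ := by linarith
  exact le_of_mul_le_mul_right this e5

set_option maxHeartbeats 1000000 in
theorem bounded_sub {n : ℕ} {p a β : ℝ} (hp : 1 < p) (hβ : β = (2 - p) / (p - 1))
    (hβ0 : 0 < β) (ha0 : 0 < a) (ha : a ^ p = a * (β + 1) / 2) {u : E n → ℝ} (hu : HS n p u) :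
    ∃ M0, 0 ≤ M0 ∧ ∀ x : E n, 0 ≤ x (Fin.last n) → u x ≤ M0 := by
  obtain ⟨C, hC0, hC⟩ := grad_bound n hp
  have hβ1 : β + 1 = (p - 1)⁻¹ := by
    have : p - 1 ≠ 0 := by linarith
    rw [hβ]; field_simp; ring
  have he : (bv (Fin.last n) : E n) (Fin.last n) = 1 := by simp
  obtain ⟨ℓ, hℓ⟩ : ∃ ℓ, ℓ = u (bv (Fin.last n)) + C / β := ⟨_, rfl⟩
  have hℓ0 : 0 ≤ ℓ := by
    have := hu.nonneg hp (y := bv (Fin.last n)) (by rw [he]; norm_num)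
    rw [hℓ]; positivity
  obtain ⟨C1, hC1⟩ : ∃ C1, C1 = C / β := ⟨_, rfl⟩
  have hC10 : 0 < C1 := by rw [hC1]; positivity
  have hgr : ∀ x : E n, 0 < x (Fin.last n) → u x ≤ ℓ + C1 * x (Fin.last n) ^ (-β) := fun x hx => by
    rw [hℓ, hC1]; exact growth_sub hp hβ1 hβ0 hC0 hu (hC u hu) hx
  obtain ⟨c, hc⟩ : ∃ c, c = (β / (2 * a)) ^ (-β⁻¹) := ⟨_, rfl⟩
  have hc0 : 0 < c := by rw [hc]; positivity
  have hcβ : a / β * c ^ (-β) = 1 / 2 := by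
    rw [hc, ← Real.rpow_mul (by positivity), neg_mul_neg, inv_mul_cancel₀ hβ0.ne', Real.rpow_one]
    field_simp
  obtain ⟨L, hL1, hLC, hLa⟩ : ∃ L : ℝ, 1 ≤ L ∧ C1 * L ^ (-β) ≤ 1 / 8 ∧ a / β * (L + c) ^ (-β) ≤ 1 / 4 := by
    have t1 : Tendsto (fun L : ℝ => C1 * L ^ (-β)) atTop (𝓝 (C1 * 0)) :=
      (tendsto_rpow_neg_atTop hβ0).const_mul C1
    have t2 : Tendsto (fun L : ℝ => a / β * (L + c) ^ (-β)) atTop (𝓝 (a / β * 0)) :=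
      ((tendsto_rpow_neg_atTop hβ0).comp (tendsto_atTop_add_const_right _ c tendsto_id)).const_mul _
    rw [mul_zero] at t1 t2
    obtain ⟨L, h1, h2, h3⟩ := ((eventually_ge_atTop (1:ℝ)).and ((t1.eventually (gt_mem_nhds
      (show (0:ℝ) < 1 / 8 by norm_num))).and (t2.eventually (gt_mem_nhds
      (show (0:ℝ) < 1 / 4 by norm_num))))).exists
    exact ⟨L, h1, h2.le, h3.le⟩
  have hL0 : 0 < L := by linarith
  have hbarL : 1 / 4 ≤ bar a c β L := by unfold bar; rw [mul_sub, hcβ]; linarith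
  obtain ⟨D, hD⟩ : ∃ D : ℝ, D = 2 ^ β := ⟨_, rfl⟩
  have hD1 : 1 ≤ D := by rw [hD]; exact Real.one_le_rpow (by norm_num) hβ0.le
  obtain ⟨K0, hK0, hbarr⟩ := barrier_sub n hp (L := L) (D := D) hβ hβ0 ha0 ha hc0 hL0 (by linarith)
  obtain ⟨K, hK⟩ : ∃ K, K = max K0 (4 * D * L) := ⟨_, rfl⟩
  have hKK : K0 ≤ K := by rw [hK]; exact le_max_left _ _
  have hKD : 4 * D * L ≤ K := by rw [hK]; exact le_max_right _ _
  have hKp : 0 < K := by linarith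
  have hDL : L ≤ D * L := le_mul_of_one_le_left hL0.le hD1
  have hLK : L ≤ K := by linarith
  obtain ⟨M0, hM0⟩ : ∃ M0 : ℝ, M0 = max (8 * ℓ) ((2 * (K + L)) ^ β) := ⟨_, rfl⟩
  have hMℓ : 8 * ℓ ≤ M0 := by rw [hM0]; exact le_max_left _ _
  have hMK : (2 * (K + L)) ^ β ≤ M0 := by rw [hM0]; exact le_max_right _ _
  have hM00 : 0 < M0 := lt_of_lt_of_le (by positivity) hMK
  refine ⟨M0, hM00.le, fun y0 hy0 => ?_⟩
  by_contra hcon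
  push Not at hcon
  obtain ⟨y, ρ, hy, -, hρ0, hρ1, hρy, hdb⟩ := doubling hu.cont hβ0 hy0 (hM00.trans hcon)
  obtain ⟨M, hM⟩ : ∃ M, M = u y := ⟨_, rfl⟩
  rw [← hM] at hρy hdb
  have hM' : 0 ≤ M := by rw [hM]; exact hu.nonneg hp hy
  have hMM : M0 < M := by
    have : M * ρ ^ β ≤ M * 1 := by
      gcongr
      exact Real.rpow_le_one hρ0.le hρ1 hβ0.le
    linarith
  have hMp : 0 < M := by linarith
  obtain ⟨r, hr⟩ : ∃ r, r = M ^ (-β⁻¹) := ⟨_, rfl⟩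
  have hr0 : 0 < r := by rw [hr]; positivity
  have hrβ : r ^ β = M⁻¹ := by
    rw [hr, ← Real.rpow_mul hMp.le, neg_mul, inv_mul_cancel₀ hβ0.ne', Real.rpow_neg_one]
  have hrρ : r * (K + L) ≤ ρ / 2 := by
    have : (2 * (K + L) * r) ^ β ≤ ρ ^ β := by
      rw [Real.mul_rpow (by positivity) hr0.le, hrβ, ← div_eq_mul_inv, div_le_iff₀ hMp]
      linarith
    have := (Real.rpow_le_rpow_iff (by positivity) hρ0.le hβ0).1 this
    linarith
  obtain ⟨x0, hx0⟩ : ∃ x0 : E n, x0 = y - y (Fin.last n) • bv (Fin.last n) := ⟨_, rfl⟩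
  have hx00 : x0 (Fin.last n) = 0 := by rw [hx0]; exact proj_zero y
  have hU := HS.scale hu hp hr0 hx00
  rw [← hβ, hrβ] at hU
  obtain ⟨s, hs⟩ : ∃ s, s = y (Fin.last n) / r := ⟨_, rfl⟩
  have hs0 : 0 ≤ s := by rw [hs]; positivity
  have hsr : r * s = y (Fin.last n) := by rw [hs]; field_simp
  have hcoord : ∀ z : E n, (x0 + r • z) (Fin.last n) = r * z (Fin.last n) := fun z => by
    simp only [PiLp.add_apply, PiLp.smul_apply, smul_eq_mul, hx00]; ring
  have hUb : ∀ z : E n, L ≤ z (Fin.last n) → M⁻¹ * u (x0 + r • z) ≤ 1 / 4 := by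
    intro z hz
    have hz0 : 0 < z (Fin.last n) := by linarith
    have h1 := hgr (x0 + r • z) (by rw [hcoord]; positivity)
    rw [hcoord, Real.mul_rpow hr0.le hz0.le, Real.rpow_neg hr0.le, hrβ, inv_inv] at h1
    have h2 : C1 * z (Fin.last n) ^ (-β) ≤ C1 * L ^ (-β) := by
      gcongr C1 * ?_
      exact Real.rpow_le_rpow_of_nonpos hL0 hz (by linarith)
    rw [inv_mul_le_iff₀ hMp]
    have h3 : M * (C1 * z (Fin.last n) ^ (-β)) ≤ M * (1 / 8) := by gcongr; linarith
    have : C1 * (M * z (Fin.last n) ^ (-β)) = M * (C1 * z (Fin.last n) ^ (-β)) := by ring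
    linarith
  have hzy : x0 + r • (s • bv (Fin.last n)) = y := by
    rw [smul_smul, hsr, hx0, sub_add_cancel]
  have hzs : (s • bv (Fin.last n) : E n) (Fin.last n) = s := by simp
  have hU1 : M⁻¹ * u (x0 + r • (s • bv (Fin.last n))) = 1 := by
    rw [hzy, ← hM, inv_mul_cancel₀ hMp.ne']
  have hsL : s < L := by
    by_contra h
    push Not at h
    have := hUb (s • bv (Fin.last n)) (by rw [hzs]; exact h)
    rw [hU1] at this
    linarith
  have hns : ‖(s • bv (Fin.last n) : E n)‖ = s := by
    rw [norm_smul, norm_bv, mul_one, Real.norm_of_nonneg hs0]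
  have hfin := hbarr K hKK _ hU (fun z hz _ => (hUb z hz.ge).trans hbarL) (fun z hz0 hzL hzK => by
    have h1 : ‖x0 + r • z - y‖ ≤ ρ / 2 := by
      have : x0 + r • z - y = r • (z - s • bv (Fin.last n)) := by
        rw [smul_sub, smul_smul, hsr, hx0]; module
      rw [this, norm_smul, Real.norm_of_nonneg hr0.le]
      refine le_trans ?_ hrρ
      gcongr
      refine (norm_sub_le _ _).trans ?_
      rw [hns]; linarith
    have h2 := hdb (x0 + r • z) (by rw [hcoord]; positivity) h1
    rw [inv_mul_le_iff₀ hMp, hD]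
    linarith) (s • bv (Fin.last n)) (by rw [hzs]; exact hs0) (by rw [hzs]; exact hsL.le)
    (by rw [hns]; linarith)
  simp only [hU1] at hfin
  rw [hzs, hns] at hfin
  have q1 : bar a c β s ≤ 1 / 2 := by
    unfold bar
    rw [mul_sub, hcβ]
    have : 0 ≤ a / β * (s + c) ^ (-β) := by positivity
    linarith
  have q2 : D / K ^ 2 * s ^ 2 ≤ 1 / 16 := by
    rw [div_mul_eq_mul_div, div_le_iff₀ (by positivity)]
    have h1 : (4 * D * L) ^ 2 ≤ K ^ 2 := by gcongr
    have h2 : D * s ^ 2 ≤ D * L ^ 2 := by gcongr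
    have h3 : D * L ^ 2 ≤ D * (D * L ^ 2) := le_mul_of_one_le_left (by positivity) hD1
    have h4 : (4 * D * L) ^ 2 = 16 * (D * (D * L ^ 2)) := by ring
    linarith
  linarith

/-- The case `p < 2`. -/
theorem uv_sub {n : ℕ} {p : ℝ} (hp : 1 < p) (hp2 : p < 2) {u : E n → ℝ} (hu : HS n p u) :
    UV n u := by
  obtain ⟨β, hβ⟩ : ∃ β, β = (2 - p) / (p - 1) := ⟨_, rfl⟩
  have hβ0 : 0 < β := by rw [hβ]; exact div_pos (by linarith) (by linarith)
  obtain ⟨a, haa⟩ : ∃ a : ℝ, a = ((β + 1) / 2) ^ (p - 1)⁻¹ := ⟨_, rfl⟩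
  have ha0 : 0 < a := by rw [haa]; positivity
  have ha : a ^ p = a * (β + 1) / 2 := by
    have h1 : a ^ (p - 1) = (β + 1) / 2 := by
      rw [haa, ← Real.rpow_mul (by positivity), inv_mul_cancel₀ (by linarith), Real.rpow_one]
    rw [mul_div_assoc, ← h1, mul_comm, ← Real.rpow_add_one ha0.ne']
    congr 1; ring
  obtain ⟨M0, hM00, hM⟩ := bounded_sub hp hβ hβ0 ha0 ha hu
  obtain ⟨c, hc0, hc⟩ : ∃ c : ℝ, 0 < c ∧ M0 ≤ bar a c β 1 := by
    obtain ⟨Q, hQ⟩ : ∃ Q, Q = M0 * β / a + 1 := ⟨_, rfl⟩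
    have hQ0 : 0 < Q := by rw [hQ]; positivity
    refine ⟨Q ^ (-β⁻¹), by positivity, ?_⟩
    unfold bar
    rw [← Real.rpow_mul hQ0.le, neg_mul_neg, inv_mul_cancel₀ hβ0.ne', Real.rpow_one]
    have h1 : (1 + Q ^ (-β⁻¹)) ^ (-β) ≤ 1 := by
      refine Real.rpow_le_one_of_one_le_of_nonpos ?_ (by linarith)
      have : 0 ≤ Q ^ (-β⁻¹) := by positivity
      linarith
    calc M0 = a / β * (M0 * β / a) := by field_simp
      _ ≤ _ := by
        gcongr
        linarith
  obtain ⟨K0, hK0, hbarr⟩ := barrier_sub n hp (L := 1) (D := M0) hβ hβ0 ha0 ha hc0 one_pos hM00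
  have hb : ∀ x : E n, 0 ≤ x (Fin.last n) → x (Fin.last n) ≤ 1 → u x ≤ bar a c β (x (Fin.last n)) := by
    intro x hx0 hx1
    have hev : ∀ᶠ K : ℝ in atTop, u x ≤ bar a c β (x (Fin.last n)) + M0 / K ^ 2 * ‖x‖ ^ 2 := by
      filter_upwards [eventually_ge_atTop K0, eventually_ge_atTop ‖x‖] with K h1 h2
      exact hbarr K h1 u hu (fun z hz _ => (hM z (by rw [hz]; norm_num)).trans hc)
        (fun z hz _ _ => hM z hz) x hx0 hx1 h2
    have hlim : Tendsto (fun K : ℝ => bar a c β (x (Fin.last n)) + M0 / K ^ 2 * ‖x‖ ^ 2) atTop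
        (𝓝 (bar a c β (x (Fin.last n)) + 0 * ‖x‖ ^ 2)) :=
      tendsto_const_nhds.add (Tendsto.mul_const _
        (tendsto_const_nhds.div_atTop (tendsto_pow_atTop (by norm_num))))
    have := ge_of_tendsto hlim hev
    simpa using this
  intro η hη
  have hlim : Tendsto (bar a c β) (𝓝[≥] 0) (𝓝 (bar a c β 0)) :=
    bar_continuousOn a hc0 0 (by simp)
  rw [bar_zero] at hlim
  have hlim' := hlim.mono_left (nhdsWithin_mono (0:ℝ) Ioi_subset_Ici_self)
  obtain ⟨b, hb1, hb2, hb0⟩ := ((hlim'.eventually (gt_mem_nhds hη)).and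
    ((show ∀ᶠ b in 𝓝[>] (0:ℝ), b ∈ Ioo (0:ℝ) 1 from Ioo_mem_nhdsGT one_pos).and
      self_mem_nhdsWithin)).exists
  have hb0' : 0 < b := hb0
  refine ⟨b, hb0, fun x hx0 hxb => (hb x hx0 (hxb.trans hb2.2.le)).trans ?_⟩
  exact (bar_mono ha0 hβ0 hc0 hx0 hxb).trans hb1.le

end OneDim

namespace OneDim
open Filter Topology Set

theorem exp_harm {n : ℕ} {u : E n → ℝ} {x g : E n} (hS : Sol 2 u x g) :
    ∃ c d : Fin (n + 1) → ℝ, (∀ i, D2 (fun t => Real.exp (u (x + t • bv i))) 0 (c i) (d i)) ∧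
      ∑ i, d i = 0 := by
  obtain ⟨h, h1, h2⟩ := hS
  refine ⟨fun i => Real.exp (u x) * g i,
    fun i => Real.exp (u x) * g i ^ 2 + Real.exp (u x) * h i, fun i => ?_, ?_⟩
  · have e := D2_exp 1 ((fun t : ℝ => u (x + t • bv i)) 0)
    have := (D2.comp (F := fun t => Real.exp (1 * t)) (f := fun t => u (x + t • bv i)) e (h1 i))
    simp only [one_mul, zero_smul, add_zero, one_pow] at this
    exact this
  · rw [Finset.sum_add_distrib, ← Finset.mul_sum, ← Finset.mul_sum, sum_sq, h2, Real.rpow_two]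
    ring

theorem comp_upper {n : ℕ} {u : E n → ℝ} (hu : HS n 2 u) {S : Set (E n)} (hS : IsCompact S)
    (hS0 : S ⊆ {x | 0 ≤ x (Fin.last n)}) {h : E n → ℝ} (hc : ContinuousOn h S)
    (H : ∀ x ∈ S, Real.exp (u x) ≤ h x ∨ (0 < x (Fin.last n) ∧ S ∈ 𝓝 x ∧
      ∃ c d : Fin (n + 1) → ℝ, (∀ i, D2 (fun t => h (x + t • bv i)) 0 (c i) (d i)) ∧ ∑ i, d i < 0)) :
    ∀ x ∈ S, Real.exp (u x) ≤ h x := by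
  intro z hz
  have hcont : ContinuousOn (fun x => Real.exp (u x) - h x) S := (hu.cont.mono hS0).rexp.sub hc
  obtain ⟨x, hx, hm⟩ := hS.exists_isMaxOn ⟨z, hz⟩ hcont
  have hm' : ∀ y ∈ S, Real.exp (u y) - h y ≤ Real.exp (u x) - h x := fun y hy => hm hy
  rcases H x hx with h1 | ⟨h1, h2, c, d, h3, h4⟩
  · have := hm' z hz
    linarith
  · exfalso
    obtain ⟨c', d', k1, k2⟩ := exp_harm (hu.sol x h1)
    have : ∀ i, d' i ≤ d i := fun i => by
      refine (touch (k1 i) (h3 i) ?_).2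
      have : ∀ᶠ y in 𝓝 x, Real.exp (u y) - h y ≤ Real.exp (u x) - h x := by
        filter_upwards [h2] with y hy using hm' y hy
      simpa using (line_tendsto x (bv i)).eventually this
    have := Finset.sum_le_sum fun i (_ : i ∈ Finset.univ) => this i
    linarith

theorem comp_lower {n : ℕ} {u : E n → ℝ} (hu : HS n 2 u) {S : Set (E n)} (hS : IsCompact S)
    (hS0 : S ⊆ {x | 0 ≤ x (Fin.last n)}) {h : E n → ℝ} (hc : ContinuousOn h S)
    (H : ∀ x ∈ S, h x ≤ Real.exp (u x) ∨ (0 < x (Fin.last n) ∧ S ∈ 𝓝 x ∧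
      ∃ c d : Fin (n + 1) → ℝ, (∀ i, D2 (fun t => h (x + t • bv i)) 0 (c i) (d i)) ∧ 0 < ∑ i, d i)) :
    ∀ x ∈ S, h x ≤ Real.exp (u x) := by
  intro z hz
  have hcont : ContinuousOn (fun x => h x - Real.exp (u x)) S := hc.sub (hu.cont.mono hS0).rexp
  obtain ⟨x, hx, hm⟩ := hS.exists_isMaxOn ⟨z, hz⟩ hcont
  have hm' : ∀ y ∈ S, h y - Real.exp (u y) ≤ h x - Real.exp (u x) := fun y hy => hm hy
  rcases H x hx with h1 | ⟨h1, h2, c, d, h3, h4⟩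
  · have := hm' z hz
    linarith
  · exfalso
    obtain ⟨c', d', k1, k2⟩ := exp_harm (hu.sol x h1)
    have : ∀ i, d i ≤ d' i := fun i => by
      refine (touch (h3 i) (k1 i) ?_).2
      have : ∀ᶠ y in 𝓝 x, h y - Real.exp (u y) ≤ h x - Real.exp (u x) := by
        filter_upwards [h2] with y hy using hm' y hy
      simpa using (line_tendsto x (bv i)).eventually this
    have := Finset.sum_le_sum fun i (_ : i ∈ Finset.univ) => this i
    linarith

theorem D2_id (x : ℝ) : D2 (fun t => t) x 1 0 :=
  ((D2.quad 0 1 0 x).congr (by ring) (by ring)).congr_fun fun t => by ring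

theorem D2_id_sq (x : ℝ) : D2 (fun t => t ^ 2) x (2 * x) 2 :=
  ((D2.quad 0 0 1 x).congr (by ring) (by ring)).congr_fun fun t => by ring

/-- Upper barrier in a half-ball. -/
theorem f_lin {n : ℕ} {u : E n → ℝ} (hu : HS n 2 u) {Q K : ℝ} (hQ : 0 < Q) (hK : 0 < K)
    (hb : ∀ z : E n, 0 ≤ z (Fin.last n) → ‖z‖ ≤ K → Real.exp (u z) - 1 ≤ Q) {s : ℝ} (hs : 0 ≤ s)
    (hsK : s ≤ K) :
    Real.exp (u (s • bv (Fin.last n))) - 1 ≤ Q * (n + 2) * s / K := by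
  obtain ⟨N, hN⟩ : ∃ N : ℝ, N = n + 1 := ⟨_, rfl⟩
  have hN0 : 0 < N := by rw [hN]; positivity
  have hn2 : (n : ℝ) + 2 = N + 1 := by rw [hN]; ring
  obtain ⟨q, hq⟩ : ∃ q, q = Q / K ^ 2 := ⟨_, rfl⟩
  have hq0 : 0 < q := by rw [hq]; positivity
  have hqK : q * K ^ 2 = Q := by rw [hq]; field_simp
  have main := comp_upper hu (compact_slab (n := n) K K) (fun z hz => hz.1.1)
    (h := fun z : E n => 1 + (q * ‖z‖ ^ 2 + q * (N + 1) * (K * z (Fin.last n) - z (Fin.last n) ^ 2)))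
    (by have := continuous_coord (Fin.last n); fun_prop) ?_ (s • bv (Fin.last n)) ?_
  · have e1 : (s • bv (Fin.last n) : E n) (Fin.last n) = s := by simp
    have e2 : ‖(s • bv (Fin.last n) : E n)‖ = s := by
      rw [norm_smul, norm_bv, mul_one, Real.norm_of_nonneg hs]
    simp only [e1, e2] at main
    have e3 : Q * (n + 2) * s / K = q * (N + 1) * (K * s) := by
      rw [hn2, ← hqK]; field_simp
    rw [e3]
    have e4 : 0 ≤ q * N * s ^ 2 := by positivity
    nlinarith [e4, main]
  · rintro z ⟨⟨hz0, hzK⟩, hzn⟩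
    rcases hz0.lt_or_eq with h0 | h0
    · rcases hzn.lt_or_eq with h1 | h1
      · right
        have hlt : z (Fin.last n) < K := (le_abs_self _).trans_lt ((abs_coord_le z _).trans_lt h1)
        refine ⟨h0, mem_of_superset ((open_slab K K).mem_nhds ⟨⟨h0, hlt⟩, h1⟩)
          (fun y hy => ⟨⟨hy.1.1.le, hy.1.2.le⟩, hy.2.le⟩), _, _, fun i =>
          (D2.const 1 0).add (((D2_sq z i).const_mul q).add ((((D2_coord i (D2_id _)).const_mul K).sub
            (D2_coord i (D2_id_sq _))).const_mul (q * (N + 1)))), ?_⟩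
        have : ∀ i, (0:ℝ) + (q * 2 + q * (N + 1) * (K * (0 * (bv (Fin.last n) : E n) i) -
            2 * (bv (Fin.last n) : E n) i)) = q * 2 + (-(2 * q * (N + 1))) * (bv (Fin.last n) : E n) i :=
          fun i => by ring
        rw [Finset.sum_congr rfl fun i _ => this i, Finset.sum_add_distrib, ← Finset.mul_sum,
          ← Finset.mul_sum, sum_bv]
        simp only [Finset.sum_const, Finset.card_univ, Fintype.card_fin, nsmul_eq_mul]
        push_cast
        rw [← hN]
        nlinarith
      · left
        have h2 := hb z hz0 hzn
        rw [h1, hqK]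
        have : 0 ≤ q * (N + 1) * (K * z (Fin.last n) - z (Fin.last n) ^ 2) := by
          have : 0 ≤ K * z (Fin.last n) - z (Fin.last n) ^ 2 := by nlinarith
          positivity
        linarith
    · left
      rw [hu.bc z h0.symm, ← h0, Real.exp_zero]
      have : 0 ≤ q * ‖z‖ ^ 2 := by positivity
      linarith
  · have e1 : (s • bv (Fin.last n) : E n) (Fin.last n) = s := by simp
    have e2 : ‖(s • bv (Fin.last n) : E n)‖ = s := by
      rw [norm_smul, norm_bv, mul_one, Real.norm_of_nonneg hs]
    exact ⟨⟨by rw [e1]; exact hs, by rw [e1]; exact hsK⟩, by rw [e2]; exact hsK⟩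

theorem HS.scale2 {n : ℕ} {u : E n → ℝ} (h : HS n 2 u) {ρ : ℝ} (hρ : 0 < ρ)
    {x0 : E n} (hx0 : x0 (Fin.last n) = 0) : HS n 2 (fun z => u (x0 + ρ • z)) := by
  have := h.scale (by norm_num) hρ hx0
  simpa using this

theorem vert_two {n : ℕ} {C : ℝ} {u : E n → ℝ}
    (hu : HS n 2 u) (hC : GB n 2 C u) {x : E n} {τ : ℝ} (hx : 0 < x (Fin.last n)) (hτ : 0 ≤ τ) :
    |u (x + τ • bv (Fin.last n)) - u x| ≤
      C * (Real.log (x (Fin.last n) + τ) - Real.log (x (Fin.last n))) := by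
  have h1 : ∀ t : ℝ, 0 < t → HasDerivAt Real.log (t ^ (-((2:ℝ) - 1)⁻¹)) t := by
    intro t ht
    refine (Real.hasDerivAt_log ht.ne').congr_deriv ?_
    rw [show -((2:ℝ) - 1)⁻¹ = -1 by norm_num, Real.rpow_neg_one]
  exact vert hu hC (H := Real.log) (τ := τ) hx.le hτ
    (fun t ht => (h1 t (hx.trans_le ht.1)).continuousAt.continuousWithinAt)
    (fun t ht _ => h1 t (hx.trans ht))

theorem horiz_two {n : ℕ} {C : ℝ} (hC0 : 0 ≤ C) {u : E n → ℝ} (hu : HS n 2 u)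
    (hC : GB n 2 C u) {x y : E n} {a : ℝ} (ha : 0 < a) (hx : a ≤ x (Fin.last n))
    (hy : a ≤ y (Fin.last n)) :
    |u y - u x| ≤ C / a * ‖y - x‖ := by
  have := horiz (by norm_num) hC0 hu hC ha hx hy
  rwa [show -((2:ℝ) - 1)⁻¹ = -1 by norm_num, Real.rpow_neg_one, ← div_eq_mul_inv] at this

/-- Harnack growth near the boundary. -/
theorem growth_two {n : ℕ} {C : ℝ} (hC0 : 0 < C) {u : E n → ℝ} (hu : HS n 2 u) (hC : GB n 2 C u)
    {x : E n} (hx : 0 < x (Fin.last n)) (hx2 : ‖x‖ ≤ 2) :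
    Real.exp (u x) ≤ Real.exp (C * (2 * Real.log 3 + 4)) * Real.exp (u (bv (Fin.last n))) *
      x (Fin.last n) ^ (-C) := by
  have he : (bv (Fin.last n) : E n) (Fin.last n) = 1 := by simp
  have hxn := (le_abs_self _).trans ((abs_coord_le x (Fin.last n)).trans hx2)
  have v1 := vert_two hu hC (τ := 3 - x (Fin.last n)) hx (by linarith)
  have v2 := vert_two hu hC (x := bv (Fin.last n)) (τ := 2) (by rw [he]; norm_num) (by norm_num)
  have v3 := horiz_two hC0.le hu hC (x := x + (3 - x (Fin.last n)) • bv (Fin.last n))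
    (y := bv (Fin.last n) + (2 : ℝ) • bv (Fin.last n)) (a := 1) one_pos
    (by rw [vline]; linarith) (by rw [vline, he]; norm_num)
  rw [show bv (Fin.last n) + (2 : ℝ) • bv (Fin.last n) -
      (x + (3 - x (Fin.last n)) • bv (Fin.last n)) = -(x - x (Fin.last n) • bv (Fin.last n)) by
        module, norm_neg] at v3
  have hn : ‖x - x (Fin.last n) • bv (Fin.last n)‖ ≤ 4 := by
    refine (norm_sub_le _ _).trans ?_
    rw [norm_smul, norm_bv, mul_one, Real.norm_of_nonneg hx.le]
    linarith
  have w1 := neg_le_of_abs_le v1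
  have w2 := le_of_abs_le v2
  have w3 := neg_le_of_abs_le v3
  rw [he, Real.log_one, show (1:ℝ) + 2 = 3 by norm_num] at w2
  rw [show x (Fin.last n) + (3 - x (Fin.last n)) = 3 by ring] at w1
  have w4 : C / 1 * ‖x - x (Fin.last n) • bv (Fin.last n)‖ ≤ C * 4 := by
    rw [div_one]; gcongr
  rw [Real.rpow_def_of_pos hx, ← Real.exp_add, ← Real.exp_add]
  refine Real.exp_le_exp.2 ?_
  linarith

end OneDim

namespace OneDim
open Filter Topology Set

/-- Carleson estimate. -/
theorem carleson (n : ℕ) : ∃ C2 : ℝ, 0 < C2 ∧ ∀ u : E n → ℝ, HS n 2 u → ∀ y0 : E n,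
    0 ≤ y0 (Fin.last n) → ‖y0‖ ≤ 1 → Real.exp (u y0) - 1 ≤ C2 * Real.exp (u (bv (Fin.last n))) := by
  obtain ⟨C, hC0, hC⟩ := grad_bound n (p := 2) (by norm_num)
  obtain ⟨B, hB⟩ : ∃ B, B = Real.exp (C * (2 * Real.log 3 + 4)) := ⟨_, rfl⟩
  have hB0 : 0 < B := by rw [hB]; positivity
  obtain ⟨D, hD⟩ : ∃ D : ℝ, D = 2 ^ C := ⟨_, rfl⟩
  have hD0 : 0 < D := by rw [hD]; positivity
  obtain ⟨K, hK⟩ : ∃ K : ℝ, K = D * (n + 2) + 1 := ⟨_, rfl⟩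
  have hK1 : 1 ≤ K := by
    have : 0 ≤ D * (n + 2) := by positivity
    linarith
  have hK0 : 0 < K := by linarith
  refine ⟨B * (2 * (K + 1)) ^ C, by positivity, fun u hu y0 hy0 hy1 => ?_⟩
  obtain ⟨A, hA⟩ : ∃ A, A = Real.exp (u (bv (Fin.last n))) := ⟨_, rfl⟩
  have hA0 : 0 < A := by rw [hA]; positivity
  rw [← hA]
  by_contra hcon
  push Not at hcon
  have hcp : 0 < B * (2 * (K + 1)) ^ C * A := by positivity
  have hFc : ContinuousOn (fun x => Real.exp (u x) - 1) {x : E n | 0 ≤ x (Fin.last n)} :=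
    hu.cont.rexp.sub continuousOn_const
  obtain ⟨y, ρ, hy, hyy, hρ0, hρ1, hρy, hdb⟩ := doubling hFc hC0 hy0 (hcp.trans hcon)
  obtain ⟨M, hM⟩ : ∃ M, M = Real.exp (u y) - 1 := ⟨_, rfl⟩
  simp only [← hM] at hρy hdb
  have hρC : 0 < ρ ^ C := by positivity
  have hMρ : 0 < M * ρ ^ C := (hcp.trans hcon).trans_le hρy
  have hM0 : 0 < M := pos_of_mul_pos_left hMρ hρC.le
  have hs0 : 0 < y (Fin.last n) := by
    refine lt_of_le_of_ne hy fun h => ?_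
    rw [hu.bc y h.symm, Real.exp_zero] at hM
    linarith
  obtain ⟨s, hs⟩ : ∃ s, s = y (Fin.last n) := ⟨_, rfl⟩
  rw [← hs] at hs0
  have hy2 : ‖y‖ ≤ 2 := by
    have : ‖y‖ ≤ ‖y - y0‖ + ‖y0‖ := norm_le_norm_sub_add _ _
    linarith
  have hg := growth_two hC0 hu (hC u hu) (hs ▸ hs0) hy2
  rw [← hB, ← hA, ← hs, Real.rpow_neg hs0.le] at hg
  have hsC : 0 < s ^ C := by positivity
  have hMs : M * s ^ C ≤ B * A := by
    have h1 : M ≤ B * A * (s ^ C)⁻¹ := by linarith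
    rwa [← div_eq_mul_inv, le_div_iff₀ hsC] at h1
  have hsρ : s * (K + 1) ≤ ρ / 2 := by
    have h1 : (2 * (K + 1) * s) ^ C ≤ ρ ^ C := by
      rw [Real.mul_rpow (by positivity) hs0.le]
      have h2 : M * ((2 * (K + 1)) ^ C * s ^ C) ≤ M * ρ ^ C := by
        have h3 : (2 * (K + 1)) ^ C * (M * s ^ C) ≤ (2 * (K + 1)) ^ C * (B * A) := by gcongr
        calc M * ((2 * (K + 1)) ^ C * s ^ C) = (2 * (K + 1)) ^ C * (M * s ^ C) := by ring
          _ ≤ (2 * (K + 1)) ^ C * (B * A) := h3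
          _ = B * (2 * (K + 1)) ^ C * A := by ring
          _ ≤ M * ρ ^ C := hcon.le.trans hρy
      exact le_of_mul_le_mul_left h2 hM0
    have := (Real.rpow_le_rpow_iff (by positivity) hρ0.le hC0).1 h1
    linarith
  obtain ⟨x0, hx0⟩ : ∃ x0 : E n, x0 = y - y (Fin.last n) • bv (Fin.last n) := ⟨_, rfl⟩
  have hx00 : x0 (Fin.last n) = 0 := by rw [hx0]; exact proj_zero y
  have hU := hu.scale2 hs0 hx00
  have hcoord : ∀ z : E n, (x0 + s • z) (Fin.last n) = s * z (Fin.last n) := fun z => by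
    simp only [PiLp.add_apply, PiLp.smul_apply, smul_eq_mul, hx00]; ring
  have hfin := f_lin hU (Q := D * M) (K := K) (by positivity) hK0 (fun z hz0 hzK => by
    refine (hdb (x0 + s • z) (by rw [hcoord]; positivity) ?_).trans (by rw [hD])
    have : x0 + s • z - y = s • (z - bv (Fin.last n)) := by
      rw [smul_sub, hx0, ← hs]; module
    rw [this, norm_smul, Real.norm_of_nonneg hs0.le]
    refine le_trans ?_ hsρ
    gcongr
    refine (norm_sub_le _ _).trans ?_
    rw [norm_bv]; linarith) (s := 1) (by norm_num) hK1
  have e : x0 + s • ((1:ℝ) • bv (Fin.last n)) = y := by rw [one_smul, hx0, ← hs, sub_add_cancel]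
  rw [e, ← hM, mul_one, le_div_iff₀ hK0, hK] at hfin
  nlinarith

/-- Lower growth bound. -/
theorem lower_two (n : ℕ) : ∃ c : ℝ, 0 < c ∧ ∀ u : E n → ℝ, HS n 2 u → ∀ s : ℝ, 0 ≤ s → s ≤ 1 →
    c * s * Real.exp (u (bv (Fin.last n))) ≤ Real.exp (u (s • bv (Fin.last n))) := by
  obtain ⟨C, hC0, hC⟩ := grad_bound n (p := 2) (by norm_num)
  obtain ⟨N, hN⟩ : ∃ N : ℝ, N = n + 1 := ⟨_, rfl⟩
  have hN1 : 1 ≤ N := by rw [hN]; simp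
  obtain ⟨B, hB⟩ : ∃ B : ℝ, B = N + 1 := ⟨_, rfl⟩
  have hB1 : 1 ≤ B := by linarith
  refine ⟨Real.exp (-(C * (2 + B))) / (1 + B), by positivity, fun u hu s hs0 hs1 => ?_⟩
  obtain ⟨A, hA⟩ : ∃ A, A = Real.exp (u (bv (Fin.last n))) := ⟨_, rfl⟩
  have hA0 : 0 < A := by rw [hA]; positivity
  obtain ⟨c, hc⟩ : ∃ c, c = Real.exp (-(C * (2 + B))) / (1 + B) * A := ⟨_, rfl⟩
  have hc0 : 0 < c := by rw [hc]; positivity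
  have he : (bv (Fin.last n) : E n) (Fin.last n) = 1 := by simp
  obtain ⟨R, hR⟩ : ∃ R, R = Real.sqrt (1 + B) := ⟨_, rfl⟩
  have hR0 : 0 ≤ R := by rw [hR]; positivity
  have hR2 : R ^ 2 = 1 + B := by rw [hR]; exact Real.sq_sqrt (by linarith)
  have hR1 : 1 ≤ R := by nlinarith
  have hRB : R ≤ 1 + B := by nlinarith
  have main := comp_lower hu (compact_slab (n := n) 1 R) (fun z hz => hz.1.1)
    (h := fun z : E n => c * (z (Fin.last n) * ((1 - ‖z‖ ^ 2) + B * z (Fin.last n) ^ 2)))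
    (by have := continuous_coord (Fin.last n); fun_prop) ?_ (s • bv (Fin.last n)) ?_
  · have e1 : (s • bv (Fin.last n) : E n) (Fin.last n) = s := by simp
    have e2 : ‖(s • bv (Fin.last n) : E n)‖ = s := by
      rw [norm_smul, norm_bv, mul_one, Real.norm_of_nonneg hs0]
    simp only [e1, e2] at main
    rw [← hA]
    refine le_trans ?_ main
    have h1 : Real.exp (-(C * (2 + B))) / (1 + B) * s * A = c * (s * 1) := by rw [hc]; ring
    rw [h1]
    gcongr
    nlinarith [mul_nonneg (sub_nonneg.2 hB1) (sq_nonneg s)]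
  · rintro z ⟨⟨hz0, hz1⟩, hzR⟩
    rcases hz0.lt_or_eq with h0 | h0
    · rcases hz1.lt_or_eq with h1 | h1
      · rcases hzR.lt_or_eq with h2 | h2
        · right
          refine ⟨h0, mem_of_superset ((open_slab 1 R).mem_nhds ⟨⟨h0, h1⟩, h2⟩)
            (fun y hy => ⟨⟨hy.1.1.le, hy.1.2.le⟩, hy.2.le⟩), _, _, fun i =>
            ((D2_coord i (D2_id (z (Fin.last n)))).mul
            (((D2.const 1 0).sub (D2_sq z i)).add
              ((D2_coord i (D2_id_sq (z (Fin.last n)))).const_mul B))).const_mul c, ?_⟩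
          simp only [zero_smul, add_zero]
          have key : ∀ i, c * (0 * (bv (Fin.last n) : E n) i * (1 - ‖z‖ ^ 2 + B * z (Fin.last n) ^ 2) +
              2 * (1 * (bv (Fin.last n) : E n) i) * (0 - 2 * z i + B * (2 * z (Fin.last n) *
                (bv (Fin.last n) : E n) i)) +
              z (Fin.last n) * (0 - 2 + B * (2 * (bv (Fin.last n) : E n) i))) =
              (c * z (Fin.last n) * (6 * B - 4)) * (bv (Fin.last n) : E n) i +
                -(2 * c * z (Fin.last n)) := by
            intro i
            rw [bv_apply]
            split_ifs with h
            · rw [← h]; ring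
            · ring
          rw [Finset.sum_congr rfl fun i _ => key i, Finset.sum_add_distrib, ← Finset.mul_sum, sum_bv]
          simp only [Finset.sum_const, Finset.card_univ, Fintype.card_fin, nsmul_eq_mul]
          push_cast
          rw [← hN, hB]
          have : c * z (Fin.last n) * (6 * (N + 1) - 4) * 1 + N * -(2 * c * z (Fin.last n)) =
            c * z (Fin.last n) * (4 * N + 2) := by ring
          rw [this]
          positivity
        · left
          refine le_trans ?_ (Real.exp_pos _).le
          rw [h2, hR2]
          have h3 : z (Fin.last n) ^ 2 ≤ 1 := by nlinarith
          have h4 : 1 - (1 + B) + B * z (Fin.last n) ^ 2 ≤ 0 := by nlinarith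
          have h5 := mul_nonpos_of_nonneg_of_nonpos hz0 h4
          exact mul_nonpos_of_nonneg_of_nonpos hc0.le h5
      · left
        rw [h1]
        have h2 := horiz_two hC0.le hu (hC u hu) (x := z) (y := bv (Fin.last n)) (a := 1) one_pos
          h1.ge he.ge
        have h3 : ‖bv (Fin.last n) - z‖ ≤ 2 + B := by
          refine (norm_sub_le _ _).trans ?_
          rw [norm_bv]; linarith
        have h4 := le_of_abs_le h2
        have h5 : C / 1 * ‖bv (Fin.last n) - z‖ ≤ C * (2 + B) := by rw [div_one]; gcongr
        have h6 : Real.exp (-(C * (2 + B))) * A ≤ Real.exp (u z) := by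
          rw [hA, ← Real.exp_add]
          exact Real.exp_le_exp.2 (by linarith)
        have h7 : c * (1 + B) = Real.exp (-(C * (2 + B))) * A := by rw [hc]; field_simp
        refine le_trans ?_ (h7 ▸ h6)
        gcongr
        nlinarith [sq_nonneg ‖z‖]
    · left
      rw [← h0]
      simpa using (Real.exp_pos _).le
  · have e1 : (s • bv (Fin.last n) : E n) (Fin.last n) = s := by simp
    have e2 : ‖(s • bv (Fin.last n) : E n)‖ = s := by
      rw [norm_smul, norm_bv, mul_one, Real.norm_of_nonneg hs0]
    exact ⟨⟨by rw [e1]; exact hs0, by rw [e1]; exact hs1⟩, by rw [e2]; linarith⟩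

/-- The case `p = 2`. -/
theorem uv_two {n : ℕ} {u : E n → ℝ} (hu : HS n 2 u) : UV n u := by
  obtain ⟨C, hC0, hC⟩ := grad_bound n (p := 2) (by norm_num)
  obtain ⟨C2, hC2, hcar⟩ := carleson n
  obtain ⟨c, hc, hlow⟩ := lower_two n
  obtain ⟨A, hA⟩ : ∃ A, A = Real.exp (u (bv (Fin.last n))) := ⟨_, rfl⟩
  have hA0 : 0 < A := by rw [hA]; positivity
  obtain ⟨Γ, hΓ⟩ : ∃ Γ : ℝ, Γ = C2 * (n + 2) * Real.exp C * A / c := ⟨_, rfl⟩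
  have hΓ0 : 0 < Γ := by rw [hΓ]; positivity
  have hb : ∀ x : E n, 0 ≤ x (Fin.last n) → u x ≤ Γ * x (Fin.last n) := by
    intro x hx
    obtain ⟨x0, hx0⟩ : ∃ x0 : E n, x0 = x - x (Fin.last n) • bv (Fin.last n) := ⟨_, rfl⟩
    have hx00 : x0 (Fin.last n) = 0 := by rw [hx0]; exact proj_zero x
    obtain ⟨R, hR⟩ : ∃ R, R = max 1 (max (x (Fin.last n)) ‖x0‖) := ⟨_, rfl⟩
    have hR1 : 1 ≤ R := by rw [hR]; exact le_max_left _ _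
    have hRx : x (Fin.last n) ≤ R := by
      rw [hR]; exact (le_max_left _ _).trans (le_max_right _ _)
    have hR0 : ‖x0‖ ≤ R := by rw [hR]; exact (le_max_right _ _).trans (le_max_right _ _)
    have hRp : 0 < R := by linarith
    have hU := hu.scale2 hRp hx00
    obtain ⟨A', hA'⟩ : ∃ A', A' = Real.exp (u (x0 + R • bv (Fin.last n))) := ⟨_, rfl⟩
    have hA'0 : 0 < A' := by rw [hA']; positivity
    have h1 := f_lin hU (Q := C2 * A') (K := 1) (by positivity) one_pos
      (fun z hz0 hz1 => by rw [hA']; exact hcar _ hU z hz0 hz1) (s := x (Fin.last n) / R)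
      (by positivity) (by rw [div_le_one hRp]; exact hRx)
    have e1 : x0 + R • ((x (Fin.last n) / R) • bv (Fin.last n)) = x := by
      rw [smul_smul, mul_div_cancel₀ _ hRp.ne', hx0, sub_add_cancel]
    rw [e1, div_one] at h1
    have hV := hu.scale2 (x0 := 0) hRp (by simp)
    have h2 := hlow _ hV (1 / R) (by positivity) (by rw [div_le_one hRp]; exact hR1)
    have e2 : (0 : E n) + R • ((1 / R) • bv (Fin.last n)) = bv (Fin.last n) := by
      rw [smul_smul, mul_div_cancel₀ _ hRp.ne', one_smul, zero_add]
    rw [e2, ← hA, zero_add] at h2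
    have h3 := horiz_two hC0.le hu (hC u hu) (x := R • bv (Fin.last n))
      (y := x0 + R • bv (Fin.last n)) (a := R) hRp (by simp) (by rw [vline, hx00, zero_add])
    rw [add_sub_cancel_right] at h3
    have h4 : C / R * ‖x0‖ ≤ C := by
      rw [div_mul_eq_mul_div, div_le_iff₀ hRp]; gcongr
    have h5 : A' ≤ Real.exp C * Real.exp (u (R • bv (Fin.last n))) := by
      rw [hA', ← Real.exp_add]
      exact Real.exp_le_exp.2 (by linarith [le_of_abs_le h3])
    have h6 : Real.exp (u (R • bv (Fin.last n))) ≤ R * A / c := by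
      rw [le_div_iff₀ hc]
      have : c * (1 / R) * Real.exp (u (R • bv (Fin.last n))) =
        Real.exp (u (R • bv (Fin.last n))) * c / R := by ring
      rw [this, div_le_iff₀ hRp] at h2
      linarith
    have h7 : A' ≤ Real.exp C * (R * A / c) := h5.trans (by gcongr)
    have h8 : C2 * A' * (n + 2) * (x (Fin.last n) / R) ≤
        C2 * (Real.exp C * (R * A / c)) * (n + 2) * (x (Fin.last n) / R) := by gcongr
    have h9 : C2 * (Real.exp C * (R * A / c)) * (n + 2) * (x (Fin.last n) / R) =
        Γ * x (Fin.last n) := by rw [hΓ]; field_simp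
    linarith [Real.add_one_le_exp (u x)]
  intro η hη
  refine ⟨η / Γ, by positivity, fun x hx hxa => (hb x hx).trans ?_⟩
  rw [le_div_iff₀ hΓ0] at hxa
  linarith

end OneDim

theorem OneDim.closure_half {n : ℕ} :
    closure (halfSpace n) = {x | 0 ≤ x (Fin.last n)} := by
  refine Set.Subset.antisymm ?_ ?_
  · refine closure_minimal (fun x (hx : 0 < x (Fin.last n)) => (show 0 ≤ x (Fin.last n) from hx.le)) ?_
    exact isClosed_le continuous_const (OneDim.continuous_coord _)
  · intro x hx
    have hx' : 0 ≤ x (Fin.last n) := hx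
    have ht := (OneDim.line_tendsto x (OneDim.bv (Fin.last n))).mono_left
      (nhdsWithin_le_nhds (s := Set.Ioi (0:ℝ)))
    refine mem_closure_of_tendsto ht ?_
    filter_upwards [self_mem_nhdsWithin] with t ht
    have ht' : 0 < t := ht
    show 0 < (x + t • OneDim.bv (Fin.last n) : OneDim.E n) (Fin.last n)
    rw [OneDim.vline]; linarith

/-- Main theorem: for `p > 1`, any classical solution of `-Δu = |∇u|^p`
in the half-space with zero boundary data depends only on the last variable `xₙ`. -/
theorem one_dimensionality (n : ℕ) (p : ℝ) (hp1 : 1 < p)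
    (u : EuclideanSpace ℝ (Fin (n + 1)) → ℝ)
    (hu2 : ContDiffOn ℝ 2 u (halfSpace n))
    (huc : ContinuousOn u (closure (halfSpace n)))
    (heq : ∀ x ∈ halfSpace n, -laplacian u x = ‖gradient u x‖ ^ p)
    (hbc : ∀ x : EuclideanSpace ℝ (Fin (n + 1)), x (Fin.last n) = 0 → u x = 0) :
    ∀ x ∈ closure (halfSpace n), ∀ y ∈ closure (halfSpace n),
      x (Fin.last n) = y (Fin.last n) → u x = u y := by
  have hS : OneDim.HS n p u := by
    refine ⟨OneDim.closure_half ▸ huc, hbc, hu2, fun x hx => ?_⟩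
    exact OneDim.sol_of_eq (hu2.contDiffAt (IsOpen.mem_nhds (OneDim.isOpen_half n) hx)) (heq x hx)
  have hv : OneDim.UV n u := by
    rcases lt_trichotomy p 2 with h | h | h
    · exact OneDim.uv_sub hp1 h hS
    · subst h
      exact OneDim.uv_two hS
    · exact OneDim.uv_super h hS
  intro x hx y _ hxy
  rw [OneDim.closure_half] at hx
  exact OneDim.conclude hp1 hS hv hx hxy
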